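/- Let n ≥ 2, q ≥ 2, p = q/(q−1), α ∈ (0,1), Ω ⊂ ℝⁿ bounded open, f ∈ B^α_{p,∞,loc}(Ω), and let u ∈ W^{1,q}_loc(Ω) be a local weak solution of −div((|∇u|−1)_+^{q−1} ∇u/|∇u|) = f; set σ₀ = H_{q−1}(∇u) (the solution of the Beckmann-type problem). Then σ₀ ∈ L^r_loc(Ω) for all r ∈ [1, np/(n−α−1)). -/

import Mathlib

open MeasureTheory Metric
open scoped RealInnerProductSpace ENNReal

/-- `H_a(ξ) = (|ξ|−1)_+^a ξ/|ξ|` (with value `0` at `ξ = 0`). -/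
noncomputable def Hmap (n : ℕ) (a : ℝ) (ξ : EuclideanSpace ℝ (Fin n)) :
    EuclideanSpace ℝ (Fin n) :=
  ((max (‖ξ‖ - 1) 0) ^ a / ‖ξ‖) • ξ

/-- The `s`-th standard unit vector `e_s` of `ℝⁿ`. -/
noncomputable def unitVec (n : ℕ) (s : Fin n) : EuclideanSpace ℝ (Fin n) :=
  EuclideanSpace.single s 1

/-- `u ∈ W^{1,q}_loc(Ω)` with weak gradient `Du`: local `L^q` integrability of `u` and `Du`,
together with the integration-by-parts identity against test functions supported in `Ω`. -/
def MemW1Loc (n : ℕ) (q : ℝ) (Ω : Set (EuclideanSpace ℝ (Fin n)))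
    (u : EuclideanSpace ℝ (Fin n) → ℝ)
    (Du : EuclideanSpace ℝ (Fin n) → EuclideanSpace ℝ (Fin n)) : Prop :=
  (∀ K : Set (EuclideanSpace ℝ (Fin n)), IsCompact K → K ⊆ Ω →
      MemLp u (ENNReal.ofReal q) (volume.restrict K) ∧
      MemLp Du (ENNReal.ofReal q) (volume.restrict K)) ∧
  (∀ φ : EuclideanSpace ℝ (Fin n) → ℝ, ContDiff ℝ 1 φ → HasCompactSupport φ →
      tsupport φ ⊆ Ω →
      ∫ x in Ω, u x • gradient φ x = -∫ x in Ω, φ x • Du x)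

/-- `u` (with gradient `Du`) is a local weak solution of
`−div((|∇u|−1)_+^{q−1} ∇u/|∇u|) = f` in `Ω`:
`∫_Ω ⟨H_{q−1}(∇u), ∇φ⟩ = ∫_Ω f φ` for all test functions `φ` supported in `Ω`. -/
def IsLocalWeakSolution (n : ℕ) (q : ℝ) (Ω : Set (EuclideanSpace ℝ (Fin n)))
    (Du : EuclideanSpace ℝ (Fin n) → EuclideanSpace ℝ (Fin n))
    (f : EuclideanSpace ℝ (Fin n) → ℝ) : Prop :=
  ∀ φ : EuclideanSpace ℝ (Fin n) → ℝ, ContDiff ℝ 1 φ → HasCompactSupport φ →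
    tsupport φ ⊆ Ω →
    ∫ x in Ω, ⟪Hmap n (q - 1) (Du x), gradient φ x⟫ = ∫ x in Ω, f x * φ x

/-- The set of Besov difference quotients of `f` on the set `B`:
`(∫_B |f(x+h e_s) − f(x)|^p / |h|^{αp} dx)^{1/p}` over directions `s` and `h ≠ 0`. -/
def besovSet (n : ℕ) (p α : ℝ) (B : Set (EuclideanSpace ℝ (Fin n)))
    (f : EuclideanSpace ℝ (Fin n) → ℝ) : Set ℝ :=
  {t : ℝ | ∃ (s : Fin n) (h : ℝ), h ≠ 0 ∧
    t = (∫ x in B, |f (x + h • unitVec n s) - f x| ^ p / |h| ^ (α * p)) ^ (1 / p)}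

/-- The Besov norm `‖f‖_{B^α_{p,∞}(B)} = ‖f‖_{L^p(B)} + sup_{h≠0} (...)^{1/p}`. -/
noncomputable def besovNormBall (n : ℕ) (p α : ℝ) (B : Set (EuclideanSpace ℝ (Fin n)))
    (f : EuclideanSpace ℝ (Fin n) → ℝ) : ℝ :=
  (∫ x in B, |f x| ^ p) ^ (1 / p) + sSup (besovSet n p α B f)

/-- `f ∈ B^α_{p,∞,loc}(Ω)`: on every ball compactly contained in `Ω`, `f ∈ L^p` and the
Besov difference quotients are bounded. -/
def MemBesovLoc (n : ℕ) (p α : ℝ) (Ω : Set (EuclideanSpace ℝ (Fin n)))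
    (f : EuclideanSpace ℝ (Fin n) → ℝ) : Prop :=
  ∀ (z : EuclideanSpace ℝ (Fin n)) (r : ℝ), 0 < r → closedBall z r ⊆ Ω →
    IntegrableOn (fun x => |f x| ^ p) (ball z r) volume ∧
    BddAbove (besovSet n p α (ball z r) f)

section PartA
set_option linter.unusedSectionVars false
open Filter Topology

lemma jensen_eLpNorm {X T F : Type*} [MeasurableSpace X] [MeasurableSpace T]
    [NormedAddCommGroup F] [NormedSpace ℝ F]
    {μ : Measure X} {ν : Measure T} [SFinite μ] [IsProbabilityMeasure ν]
    (G : X → T → F) (hG : AEStronglyMeasurable (fun z : X × T => G z.1 z.2) (μ.prod ν))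
    {Q : ℝ≥0∞} (hQ : 1 ≤ Q) (hQt : Q ≠ ∞) (C : ℝ≥0∞)
    (h : ∀ᵐ t ∂ν, eLpNorm (fun x => G x t) Q μ ≤ C) :
    eLpNorm (fun x => ∫ t, G x t ∂ν) Q μ ≤ C := by
  have hQ0 : Q ≠ 0 := (zero_lt_one.trans_le hQ).ne'
  have hq : 0 < Q.toReal := ENNReal.toReal_pos hQ0 hQt
  rw [eLpNorm_eq_lintegral_rpow_enorm_toReal hQ0 hQt]
  rw [one_div, ENNReal.rpow_inv_le_iff hq]
  calc ∫⁻ x, ‖∫ t, G x t ∂ν‖ₑ ^ Q.toReal ∂μ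
      ≤ ∫⁻ x, ∫⁻ t, ‖G x t‖ₑ ^ Q.toReal ∂ν ∂μ := by
        apply lintegral_mono_ae
        filter_upwards [hG.prodMk_left] with x hx
        have h1 := eLpNorm_le_eLpNorm_of_exponent_le (μ := ν) hQ hx
        rw [eLpNorm_one_eq_lintegral_enorm, eLpNorm_eq_lintegral_rpow_enorm_toReal hQ0 hQt, one_div,
          ENNReal.le_rpow_inv_iff hq] at h1
        refine le_trans ?_ h1
        gcongr
        exact enorm_integral_le_lintegral_enorm _
    _ = ∫⁻ t, ∫⁻ x, ‖G x t‖ₑ ^ Q.toReal ∂μ ∂ν := by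
        rw [lintegral_lintegral_swap]
        exact hG.enorm.pow_const _
    _ ≤ ∫⁻ t, C ^ Q.toReal ∂ν := by
        apply lintegral_mono_ae
        filter_upwards [h] with t ht
        rwa [eLpNorm_eq_lintegral_rpow_enorm_toReal hQ0 hQt, one_div,
          ENNReal.rpow_inv_le_iff hq] at ht
    _ = C ^ Q.toReal := by simp

variable {E : Type*} [NormedAddCommGroup E] [InnerProductSpace ℝ E] [FiniteDimensional ℝ E]
  [MeasurableSpace E] [BorelSpace E] {μ : Measure E} [μ.IsAddHaarMeasure]
variable {F : Type*} [NormedAddCommGroup F] [NormedSpace ℝ F]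

/-- Continuity of translations in `L^Q`. -/
lemma translation_cont {Q : ℝ≥0∞} (hQ : 1 ≤ Q) (hQt : Q ≠ ∞) {v : E → F} (hv : MemLp v Q μ)
    {ε : ℝ≥0∞} (hε : 0 < ε) :
    ∃ δ > 0, ∀ t : E, ‖t‖ < δ → eLpNorm (fun x => v (x + t) - v x) Q μ ≤ ε := by
  have : Fact (1 ≤ Q) := ⟨hQ⟩
  have : Fact (Q ≠ ∞) := ⟨hQt⟩
  let V : Lp F Q μ := hv.toLp v
  have hcont : Continuous (fun t : E => (DomAddAct.mk t) +ᵥ V) := by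
    have : Continuous (fun t : E => DomAddAct.mk t) := DomAddAct.continuous_mk
    fun_prop
  have h0 := (hcont.tendsto 0)
  rw [EMetric.tendsto_nhds] at h0
  have h1 := h0 ε hε
  rw [Metric.eventually_nhds_iff] at h1
  obtain ⟨δ, hδ, h⟩ := h1
  refine ⟨δ, hδ, fun t ht => ?_⟩
  have h2 := h (y := t) (by simpa using ht)
  rw [DomAddAct.mk_zero, zero_vadd] at h2
  rw [DomAddAct.mk_vadd_toLp, Lp.edist_toLp_toLp] at h2
  refine le_trans (le_of_eq ?_) h2.le
  congr 1
  ext x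
  simp [add_comm]

lemma mollify_close {Q : ℝ≥0∞} (hQ : 1 ≤ Q) (hQt : Q ≠ ∞) [CompleteSpace F] {v : E → F} (hv : MemLp v Q μ)
    {ε : ℝ≥0∞} (hε : 0 < ε) :
    ∃ δ > 0, ∀ φ : ContDiffBump (0 : E), φ.rOut < δ →
      eLpNorm (fun x => (∫ t, φ.normed μ t • v (x - t) ∂μ) - v x) Q μ ≤ ε := by
  obtain ⟨δ, hδ, h⟩ := translation_cont hQ hQt hv hε
  refine ⟨δ, hδ, fun φ hφ => ?_⟩
  have hmeas : Measurable (fun t => (φ.normed μ t).toNNReal) :=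
    (φ.continuous_normed.measurable).real_toNNReal
  let ν : Measure E := μ.withDensity (fun t => ((φ.normed μ t).toNNReal : ℝ≥0∞))
  have hνμ : ν ≪ μ := withDensity_absolutelyContinuous _ _
  have : IsProbabilityMeasure ν := by
    constructor
    simp only [ν, withDensity_apply _ MeasurableSet.univ, Measure.restrict_univ]
    have := ofReal_integral_eq_lintegral_ofReal (φ.integrable_normed (μ := μ))
      (Eventually.of_forall fun t => φ.nonneg_normed t)
    rw [φ.integral_normed] at this
    simpa [ENNReal.ofReal] using this.symm
  have hInteg : ∀ w : E → F, ∫ t, w t ∂ν = ∫ t, φ.normed μ t • w t ∂μ := by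
    intro w
    rw [integral_withDensity_eq_integral_smul hmeas]
    congr 1
    ext t
    rw [NNReal.smul_def, Real.coe_toNNReal _ (φ.nonneg_normed t)]
  have hloc : LocallyIntegrable v μ := hv.locallyIntegrable hQ
  have heq : (fun x => (∫ t, φ.normed μ t • v (x - t) ∂μ) - v x)
      = fun x => ∫ t, (v (x - t) - v x) ∂ν := by
    ext x
    rw [hInteg]
    simp_rw [smul_sub]
    rw [integral_sub]
    · rw [integral_smul_const, φ.integral_normed, one_smul]
    · have := (HasCompactSupport.convolutionExists_left (ContinuousLinearMap.lsmul ℝ ℝ)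
        (φ.hasCompactSupport_normed (μ := μ)) φ.continuous_normed hloc) x
      simpa [ConvolutionExistsAt] using this
    · exact φ.integrable_normed.smul_const _
  rw [heq]
  refine jensen_eLpNorm (fun x t => v (x - t) - v x) ?_ hQ hQt ε ?_
  · have hsub : AEStronglyMeasurable (fun z : E × E => v (z.1 - z.2)) (μ.prod μ) :=
      hv.1.comp_quasiMeasurePreserving (quasiMeasurePreserving_sub μ μ)
    have hsub' : AEStronglyMeasurable (fun z : E × E => v (z.1 - z.2)) (μ.prod ν) :=
      hsub.mono_ac (Measure.AbsolutelyContinuous.prod Measure.AbsolutelyContinuous.rfl hνμ)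
    exact hsub'.sub hv.1.comp_fst
  · have hsupp : ∀ᵐ t ∂ν, φ.normed μ t ≠ 0 := by
      rw [ae_withDensity_iff (by fun_prop)]
      refine Eventually.of_forall fun t ht h0 => ht ?_
      simp [h0]
    filter_upwards [hsupp] with t ht
    have htm : t ∈ Function.support (φ.normed μ) := ht
    rw [φ.support_normed_eq] at htm
    have := h (-t) (by simpa using (mem_ball_zero_iff.mp htm).trans hφ)
    simpa [sub_eq_add_neg] using this

/-- Smooth approximation of a globally `W^{1,Q}` function. -/
lemma approx_W1 {Q : ℝ≥0∞} (hQ : 1 ≤ Q) (hQt : Q ≠ ∞) {w : E → ℝ} {g : E → E}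
    (hw : MemLp w Q μ) (hg : MemLp g Q μ)
    (hweak : ∀ φ : E → ℝ, ContDiff ℝ 1 φ → HasCompactSupport φ →
      ∫ x, w x • gradient φ x ∂μ = -∫ x, φ x • g x ∂μ)
    {ε : ℝ≥0∞} (hε : 0 < ε) :
    ∃ v : E → ℝ, ContDiff ℝ 1 v ∧ eLpNorm (fun x => v x - w x) Q μ ≤ ε ∧
      eLpNorm (fun x => gradient v x - g x) Q μ ≤ ε := by
  obtain ⟨δ₁, hδ₁, h1⟩ := mollify_close hQ hQt hw hε
  obtain ⟨δ₂, hδ₂, h2⟩ := mollify_close hQ hQt hg hε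
  have hδ : 0 < min δ₁ δ₂ := lt_min hδ₁ hδ₂
  let φ : ContDiffBump (0 : E) := ⟨min δ₁ δ₂ / 4, min δ₁ δ₂ / 2, by positivity, by linarith⟩
  have hφ : φ.rOut < min δ₁ δ₂ := by
    change min δ₁ δ₂ / 2 < _
    linarith
  have hloc : LocallyIntegrable w μ := hw.locallyIntegrable hQ
  let v : E → ℝ := fun x => ∫ t, φ.normed μ t • w (x - t) ∂μ
  have hv : v = convolution (φ.normed μ) w (ContinuousLinearMap.lsmul ℝ ℝ) μ := by
    ext x
    simp [v, convolution]
  have hcd : ContDiff ℝ 1 (φ.normed μ) := φ.contDiff_normed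
  have hcs := φ.hasCompactSupport_normed (μ := μ)
  have hgrad : ∀ x, gradient v x = ∫ t, φ.normed μ t • g (x - t) ∂μ := by
    intro x
    have hd := hcs.hasFDerivAt_convolution_left (ContinuousLinearMap.lsmul ℝ ℝ) hcd hloc x
    rw [← hv] at hd
    have hψcd : ContDiff ℝ 1 (fun y => φ.normed μ (x - y)) := by fun_prop
    have hψcs : HasCompactSupport (fun y => φ.normed μ (x - y)) := by
      exact hcs.comp_homeomorph (Homeomorph.subLeft x)
    have hw' := hweak _ hψcd hψcs
    have hgψ : ∀ y, gradient (fun y => φ.normed μ (x - y)) y = - gradient (φ.normed μ) (x - y) := by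
      intro y
      have hdd : DifferentiableAt ℝ (φ.normed μ) (x - y) := hcd.differentiable one_ne_zero _
      have h3 : HasFDerivAt (fun y : E => x - y) (-(ContinuousLinearMap.id ℝ E)) y := by
        simpa using (hasFDerivAt_id y).const_sub x
      have h4 := (hdd.hasFDerivAt.comp y h3).hasGradientAt
      have h5 := h4.gradient
      change gradient (φ.normed μ ∘ fun y => x - y) y = _
      rw [h5]
      simp [gradient]
    simp_rw [hgψ, smul_neg] at hw'
    rw [integral_neg, neg_inj] at hw'
    have e1 : ∫ t, φ.normed μ t • g (x - t) ∂μ = ∫ y, φ.normed μ (x - y) • g y ∂μ := by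
      rw [← integral_sub_left_eq_self _ μ x]
      simp
    have e2 : ∫ y, w y • gradient (φ.normed μ) (x - y) ∂μ
        = ∫ t, w (x - t) • gradient (φ.normed μ) t ∂μ := by
      rw [← integral_sub_left_eq_self _ μ x]
      simp
    rw [e1, ← hw', e2]
    rw [hd.hasGradientAt.gradient]
    rw [convolution]
    rw [← LinearIsometryEquiv.coe_toContinuousLinearEquiv, ← ContinuousLinearEquiv.integral_comp_comm]
    congr 1
    ext1 t
    rw [gradient, LinearIsometryEquiv.coe_toContinuousLinearEquiv]
    rw [← map_smul]
    congr 1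
    ext y
    simp [ContinuousLinearMap.precompL_apply, mul_comm]
  refine ⟨v, ?_, h1 φ (hφ.trans_le (min_le_left _ _)), ?_⟩
  · rw [hv]
    exact hcs.contDiff_convolution_left (n := 1) _ hcd hloc
  · simp_rw [hgrad]
    exact h2 φ (hφ.trans_le (min_le_right _ _))

end PartA

section PartB
set_option linter.unusedSectionVars false
open Filter Topology

variable {E : Type*} [NormedAddCommGroup E] [InnerProductSpace ℝ E] [FiniteDimensional ℝ E]
  [MeasurableSpace E] [BorelSpace E] {μ : Measure E} [μ.IsAddHaarMeasure]

lemma eLpNorm_translate {F : Type*} [NormedAddCommGroup F] {Q : ℝ≥0∞} {v : E → F}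
    (hv : AEStronglyMeasurable v μ) (h : E) :
    eLpNorm (fun x => v (x + h)) Q μ = eLpNorm v Q μ :=
  eLpNorm_comp_measurePreserving hv (measurePreserving_add_right μ h)

lemma memLp_translate {F : Type*} [NormedAddCommGroup F] {Q : ℝ≥0∞} {v : E → F}
    (hv : MemLp v Q μ) (h : E) : MemLp (fun x => v (x + h)) Q μ :=
  hv.comp_measurePreserving (measurePreserving_add_right μ h)

lemma continuous_gradient {v : E → ℝ} (hv : ContDiff ℝ 1 v) : Continuous (gradient v) := by
  unfold gradient
  exact (LinearIsometryEquiv.continuous _).comp (hv.continuous_fderiv one_ne_zero)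

lemma diff_C1 {Q : ℝ≥0∞} (hQ : 1 ≤ Q) (hQt : Q ≠ ∞) {v : E → ℝ} (hv : ContDiff ℝ 1 v) (h : E) :
    eLpNorm (fun x => v (x + h) - v x) Q μ ≤ ‖h‖ₑ * eLpNorm (gradient v) Q μ := by
  have hgc := continuous_gradient hv
  have heq : (fun x => v (x + h) - v x) =
      fun x => ∫ t, ⟪gradient v (x + t • h), h⟫ ∂((volume : Measure ℝ).restrict (Set.Ioc 0 1)) := by
    ext x
    rw [← intervalIntegral.integral_of_le zero_le_one]
    have hd : ∀ t ∈ Set.uIcc (0 : ℝ) 1, HasDerivAt (fun t : ℝ => v (x + t • h))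
        ⟪gradient v (x + t • h), h⟫ t := by
      intro t _
      have h1 : HasFDerivAt v (fderiv ℝ v (x + t • h)) (x + t • h) :=
        (hv.differentiable one_ne_zero _).hasFDerivAt
      have h2 : HasDerivAt (fun t : ℝ => x + t • h) h t := by
        simpa using ((hasDerivAt_id t).smul_const h).const_add x
      have h3 := h1.comp_hasDerivAt t h2
      have h4 : fderiv ℝ v (x + t • h) h = ⟪gradient v (x + t • h), h⟫ := by
        rw [← toDual_gradient]; simp
      rwa [h4] at h3
    rw [intervalIntegral.integral_eq_sub_of_hasDerivAt hd]
    · simp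
    · apply Continuous.intervalIntegrable
      fun_prop
  rw [heq]
  have : IsProbabilityMeasure ((volume : Measure ℝ).restrict (Set.Ioc 0 1)) := ⟨by simp⟩
  refine jensen_eLpNorm (fun x (t : ℝ) => ⟪gradient v (x + t • h), h⟫) ?_ hQ hQt _ ?_
  · apply Continuous.aestronglyMeasurable
    fun_prop
  · refine Eventually.of_forall fun t => ?_
    rw [← eLpNorm_translate (v := gradient v) hgc.aestronglyMeasurable (t • h)]
    have := eLpNorm_le_nnreal_smul_eLpNorm_of_ae_le_mul (μ := μ)
      (f := fun x => ⟪gradient v (x + t • h), h⟫) (g := fun x => gradient v (x + t • h)) (c := ‖h‖₊)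
      (Eventually.of_forall fun x => ?_) Q
    · rwa [ENNReal.smul_def] at this
    · rw [mul_comm]
      exact nnnorm_inner_le_nnnorm _ _

lemma diff_W1 {Q : ℝ≥0∞} (hQ : 1 ≤ Q) (hQt : Q ≠ ∞) {w : E → ℝ} {g : E → E}
    (hw : MemLp w Q μ) (hg : MemLp g Q μ)
    (hweak : ∀ φ : E → ℝ, ContDiff ℝ 1 φ → HasCompactSupport φ →
      ∫ x, w x • gradient φ x ∂μ = -∫ x, φ x • g x ∂μ) (h : E) :
    eLpNorm (fun x => w (x + h) - w x) Q μ ≤ ‖h‖ₑ * eLpNorm g Q μ := by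
  have key : ∀ ε : ℝ≥0∞, 0 < ε → eLpNorm (fun x => w (x + h) - w x) Q μ ≤
      ‖h‖ₑ * (eLpNorm g Q μ + ε) + 2 * ε := by
    intro ε hε
    obtain ⟨v, hv, h1, h2⟩ := approx_W1 hQ hQt hw hg hweak hε
    have hgc := continuous_gradient hv
    have hm : AEStronglyMeasurable (fun x => v x - w x) μ :=
      hv.continuous.aestronglyMeasurable.sub hw.1
    have e : (fun x => w (x + h) - w x) = (fun x => v (x + h) - v x) +
      ((fun x => v x - w x) - (fun x => v (x + h) - w (x + h))) := by
      ext x; simp; ring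
    have hm2 : AEStronglyMeasurable (fun x => v (x + h) - w (x + h)) μ :=
      hm.comp_measurePreserving (measurePreserving_add_right μ h)
    have e3 := eLpNorm_translate (Q := Q) hm h
    have hmv : AEStronglyMeasurable (fun x => v (x + h) - v x) μ := by
      apply Continuous.aestronglyMeasurable
      have := hv.continuous
      fun_prop
    have e4 : eLpNorm (gradient v) Q μ ≤ eLpNorm g Q μ + ε := by
      have : gradient v = g + fun x => gradient v x - g x := by ext1 x; simp
      rw [this]
      refine (eLpNorm_add_le hg.1 (hgc.aestronglyMeasurable.sub hg.1) hQ).trans ?_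
      exact add_le_add le_rfl h2
    rw [e]
    refine (eLpNorm_add_le hmv (hm.sub hm2) hQ).trans ?_
    refine add_le_add ((diff_C1 hQ hQt hv h).trans (by gcongr)) ?_
    refine (eLpNorm_sub_le hm hm2 hQ).trans ?_
    rw [e3, two_mul]
    gcongr
  have ht : Tendsto (fun ε : ℝ≥0∞ => ‖h‖ₑ * (eLpNorm g Q μ + ε) + 2 * ε) (𝓝[>] 0)
      (𝓝 (‖h‖ₑ * (eLpNorm g Q μ + 0) + 2 * 0)) := by
    apply Tendsto.mono_left _ nhdsWithin_le_nhds
    refine Tendsto.add ?_ ?_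
    · exact ENNReal.Tendsto.const_mul (tendsto_const_nhds.add tendsto_id) (Or.inr enorm_ne_top)
    · exact ENNReal.Tendsto.const_mul tendsto_id (Or.inr (by simp))
  have := ge_of_tendsto ht (eventually_nhdsWithin_of_forall fun ε hε => key ε hε)
  simpa using this

end PartB

section PartC
set_option linter.unusedSectionVars false
open Filter Topology

variable {E : Type*} [NormedAddCommGroup E] [InnerProductSpace ℝ E] [FiniteDimensional ℝ E]
  [MeasurableSpace E] [BorelSpace E] {μ : Measure E} [μ.IsAddHaarMeasure]

/-- basic level set estimate at one level and one radius -/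
lemma level_est {W : E → ℝ} (hW : Measurable W) {l ρ : ℝ} (hl : 0 < l) (hρ : 0 < ρ)
    {D : ℝ≥0∞}
    (hD : ∀ y, ‖y‖ < ρ → ∫⁻ x, ENNReal.ofReal ((W (x + y) - W x) ^ 2) ∂μ ≤ D)
    (hB : 2 * μ {y | l / 2 < W y} ≤ μ (ball 0 ρ)) :
    ENNReal.ofReal (l ^ 2 / 8) * μ {x | l < W x} ≤ D := by
  set β := μ (ball (0 : E) ρ) with hβ
  have hβ0 : β ≠ 0 := (measure_ball_pos μ 0 hρ).ne'
  have hβt : β ≠ ∞ := measure_ball_lt_top.ne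
  have hmeas2 : Measurable (fun z : E × E => ENNReal.ofReal ((W (z.1 + z.2) - W z.1) ^ 2)) := by
    fun_prop
  -- lower bound for x in the level set
  have hlow : ∀ x, l < W x → ENNReal.ofReal (l ^ 2 / 8) * β ≤
      ∫⁻ y in ball 0 ρ, ENNReal.ofReal ((W (x + y) - W x) ^ 2) ∂μ := by
    intro x hx
    let S : Set E := {y | l / 2 < |W (x + y) - W x|} ∩ ball 0 ρ
    have hSm : MeasurableSet S := by
      refine MeasurableSet.inter ?_ measurableSet_ball
      exact measurableSet_lt measurable_const (by fun_prop)
    have hcov : ball (0 : E) ρ ⊆ S ∪ (fun y => x + y) ⁻¹' {y | l / 2 < W y} := by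
      intro y hy
      by_cases h : l / 2 < W (x + y)
      · right; exact h
      · left
        refine ⟨?_, hy⟩
        simp only [Set.mem_ofPred_eq]
        rw [abs_sub_comm]
        refine lt_of_lt_of_le ?_ (le_abs_self _)
        linarith
    have h1 : β ≤ μ S + μ {y | l / 2 < W y} := by
      refine (measure_mono hcov).trans ((measure_union_le _ _).trans ?_)
      rw [measure_preimage_add]
    have h2 : β ≤ 2 * μ S := by
      have h3 : β + β ≤ 2 * μ S + β := by
        calc β + β = 2 * β := (two_mul _).symm
          _ ≤ 2 * (μ S + μ {y | l / 2 < W y}) := by gcongr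
          _ = 2 * μ S + 2 * μ {y | l / 2 < W y} := by ring
          _ ≤ _ := by gcongr
      exact (ENNReal.add_le_add_iff_right hβt).mp h3
    calc ENNReal.ofReal (l ^ 2 / 8) * β ≤ ENNReal.ofReal (l ^ 2 / 8) * (2 * μ S) := by gcongr
      _ = ENNReal.ofReal ((l / 2) ^ 2) * μ S := by
        rw [← mul_assoc]
        congr 1
        rw [← ENNReal.ofReal_ofNat 2, ← ENNReal.ofReal_mul (by positivity)]
        congr 1; ring
      _ = ∫⁻ y in S, ENNReal.ofReal ((l / 2) ^ 2) ∂μ := by simp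
      _ ≤ ∫⁻ y in S, ENNReal.ofReal ((W (x + y) - W x) ^ 2) ∂μ := by
        apply setLIntegral_mono' hSm
        intro y hy
        apply ENNReal.ofReal_le_ofReal
        rw [← sq_abs (W (x + y) - W x)]
        exact pow_le_pow_left₀ (by positivity) hy.1.le 2
      _ ≤ _ := lintegral_mono_set Set.inter_subset_right
  have hLm : MeasurableSet {x | l < W x} := measurableSet_lt measurable_const hW
  have h5 : ENNReal.ofReal (l ^ 2 / 8) * μ {x | l < W x} * β ≤ D * β := by
    calc ENNReal.ofReal (l ^ 2 / 8) * μ {x | l < W x} * β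
        = ∫⁻ x in {x | l < W x}, ENNReal.ofReal (l ^ 2 / 8) * β ∂μ := by
          simp; ring
      _ ≤ ∫⁻ x in {x | l < W x}, ∫⁻ y in ball 0 ρ, ENNReal.ofReal ((W (x + y) - W x) ^ 2) ∂μ ∂μ :=
          setLIntegral_mono' hLm hlow
      _ ≤ ∫⁻ x, ∫⁻ y in ball 0 ρ, ENNReal.ofReal ((W (x + y) - W x) ^ 2) ∂μ ∂μ :=
          setLIntegral_le_lintegral _ _
      _ = ∫⁻ y in ball 0 ρ, ∫⁻ x, ENNReal.ofReal ((W (x + y) - W x) ^ 2) ∂μ ∂μ := by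
          rw [lintegral_lintegral_swap]
          exact hmeas2.aemeasurable
      _ ≤ ∫⁻ y in ball 0 ρ, D ∂μ := by
          apply setLIntegral_mono' measurableSet_ball
          intro y hy
          exact hD y (mem_ball_zero_iff.mp hy)
      _ = D * β := by simp [hβ]
  exact (ENNReal.mul_le_mul_iff_left hβ0 hβt).mp h5

lemma weak_gain {W : E → ℝ} (hW : Measurable W) (hW0 : ∀ x, 0 ≤ W x)
    (hd : 0 < Module.finrank ℝ E) {s A δ : ℝ} (hs : 0 < s) (hA : 0 ≤ A) (hδ : 0 < δ)
    (hdiff : ∀ y, ‖y‖ < δ →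
      ∫⁻ x, ENNReal.ofReal ((W (x + y) - W x) ^ 2) ∂μ ≤ ENNReal.ofReal (A * ‖y‖ ^ (2 * s)))
    {m : ℝ} (hm : 0 < m) (hInteg : ∫⁻ x, ENNReal.ofReal (W x ^ m) ∂μ < ∞) :
    ∃ C l₀ : ℝ, 0 < l₀ ∧ ∀ l, l₀ < l →
      μ {x | l < W x} ≤ ENNReal.ofReal (C * l ^ (-(2 + 2 * s / Module.finrank ℝ E * m))) := by
  set d : ℕ := Module.finrank ℝ E with hdd
  have hd' : (0 : ℝ) < d := by exact_mod_cast hd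
  set c := (μ (ball (0 : E) 1)).toReal with hc
  have hcpos : 0 < c := ENNReal.toReal_pos (measure_ball_pos μ 0 one_pos).ne' measure_ball_lt_top.ne
  set M := (∫⁻ x, ENNReal.ofReal (W x ^ m) ∂μ).toReal with hM
  have hM0 : 0 ≤ M := ENNReal.toReal_nonneg
  set P := 2 * 2 ^ m * (M + 1) / c with hP
  have hPpos : 0 < P := by positivity
  set K := P ^ (1 / (d : ℝ)) with hK
  have hKpos : 0 < K := by positivity
  -- eventually small radius
  have htend : Tendsto (fun l : ℝ => K * l ^ (-(m / d))) atTop (𝓝 (K * 0)) :=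
    (tendsto_rpow_neg_atTop (by positivity)).const_mul K
  rw [mul_zero] at htend
  have hev := (htend.eventually (gt_mem_nhds hδ)).and (eventually_gt_atTop 0)
  obtain ⟨l₀, hl₀⟩ := hev.exists_forall_of_atTop
  have hl₀pos : 0 < l₀ := (hl₀ l₀ le_rfl).2
  refine ⟨8 * A * K ^ (2 * s), l₀, hl₀pos, fun l hl => ?_⟩
  have hlpos : 0 < l := hl₀pos.trans hl
  set ρ := K * l ^ (-(m / d)) with hρ
  have hρpos : 0 < ρ := by positivity
  have hρδ : ρ < δ := (hl₀ l hl.le).1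
  have hρd : ρ ^ d = P * l ^ (-m) := by
    rw [hρ, mul_pow, hK, ← Real.rpow_natCast, ← Real.rpow_natCast, ← Real.rpow_mul hPpos.le,
      ← Real.rpow_mul hlpos.le]
    congr 2
    · rw [one_div_mul_cancel hd'.ne', Real.rpow_one]
    · field_simp
  have hball : μ (ball (0 : E) ρ) = ENNReal.ofReal (2 * 2 ^ m * (M + 1) * l ^ (-m)) := by
    rw [Measure.addHaar_ball_of_pos μ 0 hρpos, ← ENNReal.ofReal_toReal (measure_ball_lt_top (μ := μ) (x := (0 : E)) (r := 1)).ne,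
      ← ENNReal.ofReal_mul (by positivity), ← hdd, hρd, ← hc, hP]
    congr 1
    field_simp
  have hcheb : μ {y | l / 2 < W y} ≤ ENNReal.ofReal (2 ^ m * (M + 1) * l ^ (-m)) := by
    have h1 := mul_meas_ge_le_lintegral (μ := μ) (f := fun x => ENNReal.ofReal (W x ^ m))
      (by fun_prop) (ENNReal.ofReal ((l / 2) ^ m))
    have h2 : {y | l / 2 < W y} ⊆ {x | ENNReal.ofReal ((l / 2) ^ m) ≤ ENNReal.ofReal (W x ^ m)} := by
      intro y hy
      simp only [Set.mem_ofPred_eq] at hy ⊢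
      gcongr
    have h3 : ENNReal.ofReal ((l / 2) ^ m) * μ {y | l / 2 < W y} ≤ ENNReal.ofReal (M + 1) := by
      refine (mul_le_mul_right (measure_mono h2) _).trans (h1.trans ?_)
      rw [← ENNReal.ofReal_toReal hInteg.ne]
      exact ENNReal.ofReal_le_ofReal (by linarith)
    have h4 : (0 : ℝ) < (l / 2) ^ m := by positivity
    have h5 : ENNReal.ofReal (((l / 2) ^ m)⁻¹) * (ENNReal.ofReal ((l / 2) ^ m) * μ {y | l / 2 < W y})
        ≤ ENNReal.ofReal (((l / 2) ^ m)⁻¹) * ENNReal.ofReal (M + 1) := by gcongr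
    rw [← mul_assoc, ← ENNReal.ofReal_mul (by positivity), inv_mul_cancel₀ h4.ne',
      ENNReal.ofReal_one, one_mul, ← ENNReal.ofReal_mul (by positivity)] at h5
    refine h5.trans (le_of_eq ?_)
    congr 1
    rw [Real.div_rpow hlpos.le (by norm_num), Real.rpow_neg hlpos.le]
    field_simp
  have hmain := level_est (μ := μ) hW hlpos hρpos (D := ENNReal.ofReal (A * ρ ^ (2 * s)))
    (fun y hy => (hdiff y (hy.trans hρδ)).trans (by gcongr)) (by
      rw [hball]
      refine (mul_le_mul_right hcheb _).trans (le_of_eq ?_)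
      rw [← ENNReal.ofReal_ofNat 2, ← ENNReal.ofReal_mul (by positivity)]
      congr 1; ring)
  have h4 : (0 : ℝ) < l ^ 2 / 8 := by positivity
  have h5 : ENNReal.ofReal ((l ^ 2 / 8)⁻¹) * (ENNReal.ofReal (l ^ 2 / 8) * μ {x | l < W x})
      ≤ ENNReal.ofReal ((l ^ 2 / 8)⁻¹) * ENNReal.ofReal (A * ρ ^ (2 * s)) := by gcongr
  rw [← mul_assoc, ← ENNReal.ofReal_mul (by positivity), inv_mul_cancel₀ h4.ne',
      ENNReal.ofReal_one, one_mul, ← ENNReal.ofReal_mul (by positivity)] at h5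
  refine h5.trans (le_of_eq ?_)
  congr 1
  rw [hρ, Real.mul_rpow hKpos.le (by positivity), ← Real.rpow_mul hlpos.le, neg_add,
    Real.rpow_add hlpos, Real.rpow_neg hlpos.le 2, Real.rpow_two]
  have : -(m / d) * (2 * s) = -(2 * s / d * m) := by ring
  rw [this]
  field_simp

lemma strong_gain {W : E → ℝ} (hW : Measurable W) (hW0 : ∀ x, 0 ≤ W x)
    (hfin : μ {x | 0 < W x} < ∞) {C l₀ e m : ℝ} (hl₀ : 0 < l₀)
    (hweak : ∀ l, l₀ < l → μ {x | l < W x} ≤ ENNReal.ofReal (C * l ^ (-e)))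
    (hm : 0 < m) (hme : m < e) : ∫⁻ x, ENNReal.ofReal (W x ^ m) ∂μ < ∞ := by
  rw [lintegral_rpow_eq_lintegral_meas_lt_mul μ (Eventually.of_forall hW0) hW.aemeasurable hm]
  refine ENNReal.mul_lt_top ENNReal.ofReal_lt_top ?_
  rw [← Set.Ioc_union_Ioi_eq_Ioi hl₀.le]
  refine (lintegral_union_le _ _ _).trans_lt (ENNReal.add_lt_top.mpr ⟨?_, ?_⟩)
  · have hi : IntegrableOn (fun t : ℝ => t ^ (m - 1)) (Set.Ioc 0 l₀) := by
      rw [← intervalIntegrable_iff_integrableOn_Ioc_of_le hl₀.le]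
      exact intervalIntegral.intervalIntegrable_rpow' (by linarith)
    calc ∫⁻ t in Set.Ioc 0 l₀, μ {a | t < W a} * ENNReal.ofReal (t ^ (m - 1))
        ≤ ∫⁻ t in Set.Ioc 0 l₀, μ {x | 0 < W x} * ENNReal.ofReal (t ^ (m - 1)) := by
          apply setLIntegral_mono' measurableSet_Ioc
          intro t ht
          gcongr
          exact ht.1.le
      _ = μ {x | 0 < W x} * ∫⁻ t in Set.Ioc 0 l₀, ENNReal.ofReal (t ^ (m - 1)) := by
          rw [lintegral_const_mul' _ _ hfin.ne]
      _ < ∞ := ENNReal.mul_lt_top hfin hi.lintegral_lt_top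
  · have hi : IntegrableOn (fun t : ℝ => C * t ^ (-e + (m - 1))) (Set.Ioi l₀) :=
      (integrableOn_Ioi_rpow_of_lt (by linarith) hl₀).const_mul C
    refine lt_of_le_of_lt ?_ hi.lintegral_lt_top
    apply setLIntegral_mono' measurableSet_Ioi
    intro t ht
    have ht0 : 0 < t := hl₀.trans ht
    rw [Real.rpow_add ht0, ← mul_assoc, ENNReal.ofReal_mul' (by positivity)]
    gcongr
    exact hweak t ht

lemma embed {W : E → ℝ} (hW : Measurable W) (hW0 : ∀ x, 0 ≤ W x)
    (hfin : μ {x | 0 < W x} < ∞)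
    (hd : 0 < Module.finrank ℝ E) {s A δ : ℝ} (hs : 0 < s) (hsd : 2 * s < Module.finrank ℝ E)
    (hA : 0 ≤ A) (hδ : 0 < δ)
    (hdiff : ∀ y, ‖y‖ < δ →
      ∫⁻ x, ENNReal.ofReal ((W (x + y) - W x) ^ 2) ∂μ ≤ ENNReal.ofReal (A * ‖y‖ ^ (2 * s)))
    (hInteg : ∫⁻ x, ENNReal.ofReal (W x ^ (2 : ℝ)) ∂μ < ∞)
    {m : ℝ} (hm0 : 0 < m) (hm : m < 2 * Module.finrank ℝ E / (Module.finrank ℝ E - 2 * s)) :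
    ∫⁻ x, ENNReal.ofReal (W x ^ m) ∂μ < ∞ := by
  have hd' : (0 : ℝ) < Module.finrank ℝ E := by exact_mod_cast hd
  set κ := 2 * s / Module.finrank ℝ E with hκ
  have hκ0 : 0 < κ := by positivity
  have hκ1 : κ < 1 := by rw [hκ, div_lt_one hd']; exact hsd
  have hm' : (1 - κ) * m < 2 := by
    rw [lt_div_iff₀ (by linarith)] at hm
    rw [hκ]
    have : (1 - 2 * s / (Module.finrank ℝ E : ℝ)) * m = m * (Module.finrank ℝ E - 2 * s) / Module.finrank ℝ E := by
      field_simp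
    rw [this, div_lt_iff₀ hd']
    exact hm
  set θ := (2 - (1 - κ) * m) / 2 with hθ
  have hθ0 : 0 < θ := by rw [hθ]; linarith
  have hstep : ∀ a b : ℝ, 0 < a → 0 < b → b < 2 + κ * a → ∫⁻ x, ENNReal.ofReal (W x ^ a) ∂μ < ∞ →
      ∫⁻ x, ENNReal.ofReal (W x ^ b) ∂μ < ∞ := by
    intro a b ha hb hab hia
    obtain ⟨C, l₀, hl₀, hweak⟩ := weak_gain hW hW0 hd hs hA hδ hdiff ha hia
    exact strong_gain hW hW0 hfin hl₀ hweak hb hab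
  have hind : ∀ k : ℕ, ∫⁻ x, ENNReal.ofReal (W x ^ (min m (2 + k * θ))) ∂μ < ∞ := by
    intro k
    induction k with
    | zero =>
      refine hstep 2 _ two_pos (lt_min hm0 (by norm_num)) ?_ hInteg
      have := min_le_right m (2 + ((0 : ℕ) : ℝ) * θ)
      simp only [Nat.cast_zero, zero_mul, add_zero] at this ⊢
      linarith
    | succ k ih =>
      have hpos : ∀ k : ℕ, 0 < min m (2 + (k : ℝ) * θ) := fun k => lt_min hm0 (by positivity)
      refine hstep _ _ (hpos k) (hpos _) ?_ ih
      push_cast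
      rcases le_total m (2 + k * θ) with h | h
      · rw [min_eq_left h]
        exact (min_le_left _ _).trans_lt (by linarith)
      · rw [min_eq_right h]
        refine (min_le_right _ _).trans_lt ?_
        have : (1 - κ) * (2 + k * θ) ≤ (1 - κ) * m :=
          mul_le_mul_of_nonneg_left h (by linarith)
        have h2 : (1 - κ) * m = 2 - 2 * θ := by rw [hθ]; ring
        nlinarith
  obtain ⟨k, hk⟩ := exists_nat_gt (m / θ)
  have := hind k
  rwa [min_eq_left] at this
  rw [div_lt_iff₀ hθ0] at hk
  linarith

end PartC

section PartD
set_option linter.unusedSimpArgs false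

lemma rpow_sub_le {k s t : ℝ} (hk : 1 ≤ k) (hs : 0 ≤ s) (hst : s ≤ t) :
    t ^ k - s ^ k ≤ k * t ^ (k - 1) * (t - s) := by
  rcases hs.trans hst |>.eq_or_lt with h | ht
  · have : s = t := by linarith
    subst this; simp
  · have h1 := one_add_mul_self_le_rpow_one_add (s := s / t - 1) (by
      have : 0 ≤ s / t := by positivity
      linarith) hk
    rw [add_sub_cancel, Real.div_rpow hs ht.le, le_div_iff₀ (by positivity)] at h1
    rw [Real.rpow_sub_one ht.ne']
    have e : (1 + k * (s / t - 1)) * t ^ k = t ^ k - k * (t ^ k / t) * (t - s) := by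
      field_simp; ring
    linarith

lemma rpow_sub_ge {q s t : ℝ} (hq : 2 ≤ q) (hs : 0 ≤ s) (hst : s ≤ t) :
    t ^ (q - 2) * (t - s) ≤ t ^ (q - 1) - s ^ (q - 1) := by
  have e : ∀ r : ℝ, 0 ≤ r → r ^ (q - 1) = r ^ (q - 2) * r := by
    intro r hr
    rw [← Real.rpow_add_one' hr (by linarith)]
    congr 1; ring
  rw [e t (hs.trans hst), e s hs]
  have : s ^ (q - 2) * s ≤ t ^ (q - 2) * s := by
    gcongr
  linarith

/-- positive part of `|ξ| - 1` -/
noncomputable def tauF {n : ℕ} (ξ : EuclideanSpace ℝ (Fin n)) : ℝ := max (‖ξ‖ - 1) 0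

variable {n : ℕ}

lemma tauF_nonneg (ξ : EuclideanSpace ℝ (Fin n)) : 0 ≤ tauF ξ := le_max_right _ _

lemma tauF_le (ξ : EuclideanSpace ℝ (Fin n)) : tauF ξ ≤ ‖ξ‖ :=
  max_le (by linarith) (norm_nonneg _)

lemma Hmap_eq {q : ℝ} (ξ : EuclideanSpace ℝ (Fin n)) :
    Hmap n (q - 1) ξ = (tauF ξ ^ (q - 1) / ‖ξ‖) • ξ := rfl

lemma quot_mul {q : ℝ} (hq : 2 ≤ q) (ξ : EuclideanSpace ℝ (Fin n)) :
    tauF ξ ^ (q - 1) / ‖ξ‖ * ‖ξ‖ = tauF ξ ^ (q - 1) := by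
  by_cases h : ‖ξ‖ = 0
  · have : tauF ξ = 0 := le_antisymm ((tauF_le ξ).trans h.le) (tauF_nonneg ξ)
    rw [h, this, Real.zero_rpow (by linarith)]; simp
  · field_simp

lemma norm_Hmap {q : ℝ} (hq : 2 ≤ q) (ξ : EuclideanSpace ℝ (Fin n)) :
    ‖Hmap n (q - 1) ξ‖ = tauF ξ ^ (q - 1) := by
  rw [Hmap_eq, norm_smul, Real.norm_of_nonneg, quot_mul hq]
  have := tauF_nonneg ξ
  positivity

lemma quot_le {q : ℝ} (hq : 2 ≤ q) (ξ : EuclideanSpace ℝ (Fin n)) :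
    tauF ξ ^ (q - 1) / ‖ξ‖ ≤ ‖ξ‖ ^ (q - 2) := by
  by_cases h : ‖ξ‖ = 0
  · rw [h]; simp
    positivity
  · rw [div_le_iff₀ (lt_of_le_of_ne (norm_nonneg _) (Ne.symm h)),
      ← Real.rpow_add_one' (norm_nonneg _) (by linarith)]
    have : q - 2 + 1 = q - 1 := by ring
    rw [this]
    exact Real.rpow_le_rpow (tauF_nonneg _) (tauF_le _) (by linarith)

lemma H_key {q : ℝ} (hq : 2 ≤ q) (a b : EuclideanSpace ℝ (Fin n)) :
    (tauF a ^ (q / 2) - tauF b ^ (q / 2)) ^ 2 ≤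
        q ^ 2 * ⟪Hmap n (q - 1) a - Hmap n (q - 1) b, a - b⟫ ∧
    ‖Hmap n (q - 1) a - Hmap n (q - 1) b‖ ^ 2 ≤ q * (‖a‖ ^ (q - 2) + ‖b‖ ^ (q - 2)) *
        ⟪Hmap n (q - 1) a - Hmap n (q - 1) b, a - b⟫ := by
  wlog hab : ‖b‖ ≤ ‖a‖ generalizing a b
  · have := this b a (by linarith)
    have e : ⟪Hmap n (q - 1) a - Hmap n (q - 1) b, a - b⟫ =
        ⟪Hmap n (q - 1) b - Hmap n (q - 1) a, b - a⟫ := by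
      rw [← neg_sub, ← neg_sub b a, inner_neg_neg]
    rw [e, norm_sub_rev, add_comm (‖a‖ ^ (q - 2)), sub_sq_comm]
    exact this
  have hta := tauF_nonneg a
  have htb := tauF_nonneg b
  have htab : tauF b ≤ tauF a := max_le_max (by linarith) le_rfl
  have htab' : tauF a - tauF b ≤ ‖a‖ - ‖b‖ := by
    unfold tauF
    rcases max_cases (‖a‖ - 1) 0 with h | h <;> rcases max_cases (‖b‖ - 1) 0 with h' | h' <;> linarith
  have hNab : tauF b ^ (q - 1) ≤ tauF a ^ (q - 1) := Real.rpow_le_rpow htb htab (by linarith)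
  have hX : 0 ≤ ‖a‖ * ‖b‖ - ⟪a, b⟫ := by linarith [real_inner_le_norm a b]
  have hxa := quot_mul hq a
  have hyb := quot_mul hq b
  have hxle := quot_le hq a
  have hyle := quot_le hq b
  have hx0 : 0 ≤ tauF a ^ (q - 1) / ‖a‖ := by positivity
  have hy0 : 0 ≤ tauF b ^ (q - 1) / ‖b‖ := by positivity
  have hS1 := rpow_sub_le (k := q / 2) (by linarith) htb htab
  have hS1' := rpow_sub_le (k := q - 1) (by linarith) htb htab
  have hS2 := rpow_sub_ge hq htb htab
  have hS0 : 0 ≤ tauF a ^ (q / 2) - tauF b ^ (q / 2) := by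
    have := Real.rpow_le_rpow htb htab (show 0 ≤ q / 2 by linarith)
    linarith
  have hpw : (tauF a ^ (q / 2 - 1)) ^ 2 = tauF a ^ (q - 2) := by
    rw [← Real.rpow_natCast, ← Real.rpow_mul hta]; congr 1; push_cast; ring
  have hta2 : tauF a ^ (q - 2) ≤ ‖a‖ ^ (q - 2) := Real.rpow_le_rpow hta (tauF_le a) (by linarith)
  have hta20 : 0 ≤ tauF a ^ (q - 2) := by positivity
  have e11 : q - 1 - 1 = q - 2 := by ring
  rw [e11] at hS1'
  rw [Hmap_eq, Hmap_eq]
  set x := tauF a ^ (q - 1) / ‖a‖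
  set y := tauF b ^ (q - 1) / ‖b‖
  set A := tauF a ^ (q - 1)
  set B := tauF b ^ (q - 1)
  set α := ‖a‖ ^ (q - 2)
  set β := ‖b‖ ^ (q - 2)
  set T := tauF a ^ (q - 2)
  have hβ0 : 0 ≤ β := by positivity
  have hD : ⟪x • a - y • b, a - b⟫ =
      (A - B) * (‖a‖ - ‖b‖) + (x + y) * (‖a‖ * ‖b‖ - ⟪a, b⟫) := by
    simp only [inner_sub_left, inner_sub_right, inner_smul_left, inner_smul_right,
      real_inner_self_eq_norm_sq, real_inner_comm a b]
    simp
    rw [← hxa, ← hyb]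
    ring
  have hN : ‖x • a - y • b‖ ^ 2 = (A - B) ^ 2 + 2 * (x * y) * (‖a‖ * ‖b‖ - ⟪a, b⟫) := by
    rw [← real_inner_self_eq_norm_sq]
    simp only [inner_sub_left, inner_sub_right, inner_smul_left, inner_smul_right,
      real_inner_self_eq_norm_sq, real_inner_comm a b]
    simp
    rw [← hxa, ← hyb]
    ring
  set X := ‖a‖ * ‖b‖ - ⟪a, b⟫
  have hd0 : 0 ≤ tauF a - tauF b := by linarith
  have hAB0 : 0 ≤ A - B := by linarith
  have hp1 : (A - B) * (tauF a - tauF b) ≤ (A - B) * (‖a‖ - ‖b‖) :=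
    mul_le_mul_of_nonneg_left htab' hAB0
  have hxyX : 0 ≤ (x + y) * X := by positivity
  rw [hD, hN]
  constructor
  · calc (tauF a ^ (q / 2) - tauF b ^ (q / 2)) ^ 2
        ≤ (q / 2 * tauF a ^ (q / 2 - 1) * (tauF a - tauF b)) ^ 2 := pow_le_pow_left₀ hS0 hS1 2
      _ = (q / 2) ^ 2 * (T * (tauF a - tauF b) * (tauF a - tauF b)) := by rw [← hpw]; ring
      _ ≤ q ^ 2 * (T * (tauF a - tauF b) * (tauF a - tauF b)) := by
        gcongr
        linarith
      _ ≤ q ^ 2 * ((A - B) * (‖a‖ - ‖b‖) + (x + y) * X) := by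
        gcongr
        have : T * (tauF a - tauF b) * (tauF a - tauF b) ≤ (A - B) * (tauF a - tauF b) := by gcongr
        linarith
  · have h1 : (A - B) ^ 2 ≤ q * α * ((A - B) * (‖a‖ - ‖b‖)) := by
      calc (A - B) ^ 2 = (A - B) * (A - B) := by ring
        _ ≤ (A - B) * ((q - 1) * T * (tauF a - tauF b)) := by gcongr
        _ = (q - 1) * T * ((A - B) * (tauF a - tauF b)) := by ring
        _ ≤ q * α * ((A - B) * (‖a‖ - ‖b‖)) := by
          gcongr
          linarith
    have h2 : 2 * (x * y) * X ≤ q * (α + β) * ((x + y) * X) := by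
      have : x * y + y * x ≤ α * y + β * x := by gcongr
      have h3 : α * y + β * x ≤ (α + β) * (x + y) := by nlinarith
      have h4 : (α + β) * (x + y) ≤ q * ((α + β) * (x + y)) :=
        le_mul_of_one_le_left (by positivity) (by linarith)
      calc 2 * (x * y) * X = (x * y + y * x) * X := by ring
        _ ≤ (q * ((α + β) * (x + y))) * X := by gcongr; linarith
        _ = _ := by ring
    have h5 : 0 ≤ q * β * ((A - B) * (‖a‖ - ‖b‖)) := by
      have : 0 ≤ ‖a‖ - ‖b‖ := by linarith
      positivity
    nlinarith

lemma D_nonneg {q : ℝ} (hq : 2 ≤ q) (a b : EuclideanSpace ℝ (Fin n)) :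
    0 ≤ ⟪Hmap n (q - 1) a - Hmap n (q - 1) b, a - b⟫ := by
  have h := (H_key hq a b).1
  have : 0 < q ^ 2 := by positivity
  by_contra hneg
  push Not at hneg
  nlinarith [sq_nonneg (tauF a ^ (q / 2) - tauF b ^ (q / 2)), mul_neg_of_pos_of_neg this hneg]

lemma rpow_mul_sq_le {q x y : ℝ} (hq : 2 ≤ q) (hx : 0 ≤ x) (hy : 0 ≤ y) :
    x ^ (q - 2) * y ^ 2 ≤ x ^ q + y ^ q := by
  have e : ∀ r : ℝ, 0 ≤ r → r ^ q = r ^ (q - 2) * r ^ 2 := by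
    intro r hr
    rw [← Real.rpow_two, ← Real.rpow_add' hr (by linarith)]
    congr 1; ring
  rw [e x hx, e y hy]
  rcases le_total x y with h | h
  · have : x ^ (q - 2) * y ^ 2 ≤ y ^ (q - 2) * y ^ 2 := by
      gcongr
    have : 0 ≤ x ^ (q - 2) * x ^ 2 := by positivity
    linarith
  · have : x ^ (q - 2) * y ^ 2 ≤ x ^ (q - 2) * x ^ 2 := by gcongr
    have : 0 ≤ y ^ (q - 2) * y ^ 2 := by positivity
    linarith

end PartD

section PartE
set_option linter.unusedSectionVars false
open Filter Topology

variable {E : Type*} [NormedAddCommGroup E] [InnerProductSpace ℝ E] [FiniteDimensional ℝ E]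
  [MeasurableSpace E] [BorelSpace E] {μ : Measure E} [μ.IsAddHaarMeasure]

/-- The tested, translated expression. -/
noncomputable def Jop (S : E → E) (Φ η : E → ℝ) (h : E) (a : E → E) (b : E → ℝ) (x : E) : ℝ :=
  ⟪S x, (η x) ^ 2 • (a (x + h) - a x) + (2 * η x * (b (x + h) - b x)) • gradient η x⟫
    - Φ x * ((η x) ^ 2 * (b (x + h) - b x))

lemma Jop_sub (S : E → E) (Φ η : E → ℝ) (h : E) (a a' : E → E) (b b' : E → ℝ) (x : E) :
    Jop S Φ η h (fun x => a x - a' x) (fun x => b x - b' x) x =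
      Jop S Φ η h a b x - Jop S Φ η h a' b' x := by
  simp only [Jop, inner_add_right, inner_smul_right, inner_sub_right]
  ring

lemma Jop_meas {S : E → E} {Φ η : E → ℝ} (hS : AEStronglyMeasurable S μ)
    (hΦ : AEStronglyMeasurable Φ μ) (hη : ContDiff ℝ 1 η) (h : E) {a : E → E} {b : E → ℝ}
    (ha : AEStronglyMeasurable a μ) (hb : AEStronglyMeasurable b μ) :
    AEStronglyMeasurable (Jop S Φ η h a b) μ := by
  have h1 : AEStronglyMeasurable (fun x => a (x + h)) μ :=
    ha.comp_measurePreserving (measurePreserving_add_right μ h)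
  have h2 : AEStronglyMeasurable (fun x => b (x + h)) μ :=
    hb.comp_measurePreserving (measurePreserving_add_right μ h)
  have h3 : AEStronglyMeasurable η μ := hη.continuous.aestronglyMeasurable
  have h4 : AEStronglyMeasurable (gradient η) μ := (continuous_gradient hη).aestronglyMeasurable
  have h5 := h2.sub hb
  exact (hS.inner (((h3.pow 2).smul (h1.sub ha)).add (((h3.const_mul 2).mul h5).smul h4))).sub
    (hΦ.mul ((h3.pow 2).mul h5))

lemma Jop_bound {P Q : ℝ≥0∞} (hQ : 1 ≤ Q) [P.HolderTriple Q 1] {S : E → E} {Φ η : E → ℝ}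
    (hS : AEStronglyMeasurable S μ)
    (hΦ : AEStronglyMeasurable Φ μ) (h : E) {a : E → E} {b : E → ℝ}
    (ha : AEStronglyMeasurable a μ) (hb : AEStronglyMeasurable b μ)
    (hη0 : ∀ x, 0 ≤ η x) (hη1 : ∀ x, η x ≤ 1) {L : ℝ} (hL : ∀ x, ‖gradient η x‖ ≤ L) :
    eLpNorm (Jop S Φ η h a b) 1 μ ≤
      eLpNorm S P μ * (2 * eLpNorm a Q μ)
      + (eLpNorm (fun x => (2 * L) * ‖S x‖ + ‖Φ x‖) P μ) * (2 * eLpNorm b Q μ) := by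
  have hL0 : 0 ≤ L := (norm_nonneg _).trans (hL 0)
  have h1 : AEStronglyMeasurable (fun x => a (x + h)) μ :=
    ha.comp_measurePreserving (measurePreserving_add_right μ h)
  have h2 : AEStronglyMeasurable (fun x => b (x + h)) μ :=
    hb.comp_measurePreserving (measurePreserving_add_right μ h)
  have hda : eLpNorm (fun x => a (x + h) - a x) Q μ ≤ 2 * eLpNorm a Q μ := by
    refine (eLpNorm_sub_le h1 ha hQ).trans ?_
    rw [eLpNorm_translate ha, two_mul]
  have hdb : eLpNorm (fun x => b (x + h) - b x) Q μ ≤ 2 * eLpNorm b Q μ := by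
    refine (eLpNorm_sub_le h2 hb hQ).trans ?_
    rw [eLpNorm_translate hb, two_mul]
  have hm1 : AEStronglyMeasurable (fun x => ‖S x‖ * ‖a (x + h) - a x‖) μ :=
    hS.norm.mul (h1.sub ha).norm
  have hm3 : AEStronglyMeasurable (fun x => (2 * L) * ‖S x‖ + ‖Φ x‖) μ :=
    (hS.norm.const_mul _).add hΦ.norm
  have hm2 : AEStronglyMeasurable (fun x => ((2 * L) * ‖S x‖ + ‖Φ x‖) * ‖b (x + h) - b x‖) μ :=
    hm3.mul (h2.sub hb).norm
  have hpt : ∀ x, ‖Jop S Φ η h a b x‖ ≤ ‖((fun x => ‖S x‖ * ‖a (x + h) - a x‖) +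
      (fun x => ((2 * L) * ‖S x‖ + ‖Φ x‖) * ‖b (x + h) - b x‖)) x‖ := by
    intro x
    simp only [Pi.add_apply]
    refine le_trans ?_ (le_abs_self _)
    have h0 := hη0 x
    have h1' := hη1 x
    have hsq : (η x) ^ 2 ≤ 1 := pow_le_one₀ h0 h1'
    unfold Jop
    refine (norm_sub_le _ _).trans ?_
    have e1 : ‖⟪S x, (η x) ^ 2 • (a (x + h) - a x) + (2 * η x * (b (x + h) - b x)) • gradient η x⟫‖
        ≤ ‖S x‖ * (‖a (x + h) - a x‖ + 2 * L * ‖b (x + h) - b x‖) := by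
      refine (norm_inner_le_norm _ _).trans ?_
      gcongr
      refine (norm_add_le _ _).trans ?_
      rw [norm_smul, norm_smul]
      refine add_le_add ?_ ?_
      · rw [Real.norm_of_nonneg (by positivity)]
        exact mul_le_of_le_one_left (norm_nonneg _) hsq
      · rw [norm_mul, norm_mul, Real.norm_of_nonneg h0]
        simp only [Real.norm_ofNat]
        calc 2 * η x * ‖b (x + h) - b x‖ * ‖gradient η x‖ ≤ 2 * 1 * ‖b (x + h) - b x‖ * L := by
              gcongr
              exact hL x
          _ = _ := by ring
    have e2 : ‖Φ x * ((η x) ^ 2 * (b (x + h) - b x))‖ ≤ ‖Φ x‖ * ‖b (x + h) - b x‖ := by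
      rw [norm_mul, norm_mul, Real.norm_of_nonneg (sq_nonneg (η x))]
      gcongr
      exact mul_le_of_le_one_left (norm_nonneg _) hsq
    calc _ ≤ ‖S x‖ * (‖a (x + h) - a x‖ + 2 * L * ‖b (x + h) - b x‖) +
          ‖Φ x‖ * ‖b (x + h) - b x‖ := add_le_add e1 e2
      _ = _ := by ring
  refine (eLpNorm_mono hpt).trans ((eLpNorm_add_le hm1 hm2 le_rfl).trans (add_le_add ?_ ?_))
  · have := eLpNorm_le_eLpNorm_mul_eLpNorm_of_nnnorm (p := P) (q := Q) (r := 1) hS (h1.sub ha)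
      (fun u v => ‖u‖ * ‖v‖) 1 (Eventually.of_forall fun x => by simp)
    refine this.trans ?_
    rw [ENNReal.coe_one, one_mul]
    gcongr
    exact hda
  · have := eLpNorm_le_eLpNorm_mul_eLpNorm_of_nnnorm (p := P) (q := Q) (r := 1) hm3 (h2.sub hb)
      (fun u v => u * ‖v‖) 1 (Eventually.of_forall fun x => by simp)
    refine this.trans ?_
    rw [ENNReal.coe_one, one_mul]
    gcongr
    exact hdb

lemma gradient_test {η v : E → ℝ} (hη : ContDiff ℝ 1 η) (hv : ContDiff ℝ 1 v) (h x : E) :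
    gradient (fun x => (η x) ^ 2 * (v (x + h) - v x)) x =
      (η x) ^ 2 • (gradient v (x + h) - gradient v x) + (2 * η x * (v (x + h) - v x)) • gradient η x := by
  have d1 : HasFDerivAt η (fderiv ℝ η x) x := (hη.differentiable one_ne_zero x).hasFDerivAt
  have d2 : HasFDerivAt v (fderiv ℝ v x) x := (hv.differentiable one_ne_zero x).hasFDerivAt
  have d3 : HasFDerivAt (fun x => v (x + h)) (fderiv ℝ v (x + h)) x :=
    (hasFDerivAt_comp_add_right h).mpr (hv.differentiable one_ne_zero (x + h)).hasFDerivAt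
  have d4 := ((d1.pow 2).mul (d3.sub d2)).hasGradientAt.gradient
  refine Eq.trans d4 ?_
  simp only [gradient, map_add, map_smul, map_sub, Pi.sub_apply]
  simp only [smul_smul]
  congr 2
  simp
  ring

lemma J_zero {P Q : ℝ≥0∞} (hQ : 1 ≤ Q) (hQt : Q ≠ ∞) [P.HolderTriple Q 1] {S : E → E} {Φ η : E → ℝ}
    (hS : MemLp S P μ) (hΦ : MemLp Φ P μ) (hη : ContDiff ℝ 1 η)
    (hη0 : ∀ x, 0 ≤ η x) (hη1 : ∀ x, η x ≤ 1) {L : ℝ} (hL : ∀ x, ‖gradient η x‖ ≤ L)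
    {K : Set E} (hηK : tsupport η ⊆ K) (hK : IsCompact K)
    (htest : ∀ ψ : E → ℝ, ContDiff ℝ 1 ψ → HasCompactSupport ψ → tsupport ψ ⊆ K →
      ∫ x, ⟪S x, gradient ψ x⟫ ∂μ = ∫ x, Φ x * ψ x ∂μ)
    {w : E → ℝ} {g : E → E}
    (hw : MemLp w Q μ) (hg : MemLp g Q μ)
    (hweak : ∀ φ : E → ℝ, ContDiff ℝ 1 φ → HasCompactSupport φ →
      ∫ x, w x • gradient φ x ∂μ = -∫ x, φ x • g x ∂μ) (h : E) :
    Integrable (Jop S Φ η h g w) μ ∧ ∫ x, Jop S Φ η h g w x ∂μ = 0 := by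
  have hconstmem : MemLp (fun x => (2 * L) * ‖S x‖ + ‖Φ x‖) P μ :=
    (hS.norm.const_mul (2 * L)).add hΦ.norm
  have hmem : ∀ (a : E → E) (b : E → ℝ), MemLp a Q μ → MemLp b Q μ →
      Integrable (Jop S Φ η h a b) μ := by
    intro a b ha hb
    rw [← memLp_one_iff_integrable]
    refine ⟨Jop_meas hS.1 hΦ.1 hη h ha.1 hb.1, ?_⟩
    refine (Jop_bound (P := P) hQ hS.1 hΦ.1 h ha.1 hb.1 hη0 hη1 hL).trans_lt ?_
    refine ENNReal.add_lt_top.mpr ⟨?_, ?_⟩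
    · exact ENNReal.mul_lt_top hS.2 (ENNReal.mul_lt_top (by simp) ha.2)
    · exact ENNReal.mul_lt_top hconstmem.2 (ENNReal.mul_lt_top (by simp) hb.2)
  refine ⟨hmem g w hg hw, ?_⟩
  set C := eLpNorm S P μ * 2 + (eLpNorm (fun x => (2 * L) * ‖S x‖ + ‖Φ x‖) P μ) * 2 with hC
  have hCt : C ≠ ∞ := by
    refine (ENNReal.add_lt_top.mpr ⟨?_, ?_⟩).ne
    · exact ENNReal.mul_lt_top hS.2 (by simp)
    · exact ENNReal.mul_lt_top hconstmem.2 (by simp)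
  have key : ∀ ε : ℝ≥0∞, 0 < ε → ε < ∞ → ‖∫ x, Jop S Φ η h g w x ∂μ‖ₑ ≤ C * ε := by
    intro ε hε hεt
    obtain ⟨v, hv, h1, h2⟩ := approx_W1 hQ hQt hw hg hweak hε
    have hgc := continuous_gradient hv
    have hd1 : MemLp (fun x => v x - w x) Q μ :=
      ⟨hv.continuous.aestronglyMeasurable.sub hw.1, h1.trans_lt hεt⟩
    have hd2 : MemLp (fun x => gradient v x - g x) Q μ :=
      ⟨hgc.aestronglyMeasurable.sub hg.1, h2.trans_lt hεt⟩
    have hvm : MemLp v Q μ := by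
      have := hd1.add hw
      convert! this using 1
      ext x; simp
    have hgm : MemLp (gradient v) Q μ := by
      have := hd2.add hg
      convert! this using 1
      ext1 x; simp
    have hz : ∫ x, Jop S Φ η h (gradient v) v x ∂μ = 0 := by
      let ψ : E → ℝ := fun x => (η x) ^ 2 * (v (x + h) - v x)
      have hψ : ContDiff ℝ 1 ψ := by
        have : ContDiff ℝ 1 (fun x => v (x + h)) := hv.comp (contDiff_id.add contDiff_const)
        exact (hη.pow 2).mul (this.sub hv)
      have hψK : tsupport ψ ⊆ K := by
        refine subset_trans (closure_mono ?_) hηK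
        intro x hx
        simp only [Function.mem_support, ψ] at hx ⊢
        intro h0
        simp [h0] at hx
      have hψc : HasCompactSupport ψ := hK.of_isClosed_subset (isClosed_tsupport _) hψK
      have ht := htest ψ hψ hψc hψK
      have hψq : MemLp ψ Q μ := hψ.continuous.memLp_of_hasCompactSupport hψc
      have hgψc : HasCompactSupport (gradient ψ) := by
        refine (hψc.fderiv (𝕜 := ℝ)).mono ?_
        intro x hx
        simp only [Function.mem_support, gradient] at hx ⊢
        intro h0
        simp [h0] at hx
      have hgψq : MemLp (gradient ψ) Q μ :=
        (continuous_gradient hψ).memLp_of_hasCompactSupport hgψc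
      have i1 : Integrable (fun x => Φ x * ψ x) μ := hΦ.integrable_mul hψq
      have i2 : Integrable (fun x => ⟪S x, gradient ψ x⟫) μ := by
        have hb : MemLp (fun x => ‖S x‖ * ‖gradient ψ x‖) 1 μ := by
          rw [memLp_one_iff_integrable]
          exact hS.norm.integrable_mul hgψq.norm
        rw [← memLp_one_iff_integrable]
        refine hb.mono (hS.1.inner hgψq.1) (Eventually.of_forall fun x => ?_)
        refine (norm_inner_le_norm _ _).trans (le_abs_self _)
      have : ∀ x, Jop S Φ η h (gradient v) v x = ⟪S x, gradient ψ x⟫ - Φ x * ψ x := by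
        intro x
        simp only [Jop, ψ]
        rw [gradient_test hη hv]
      simp_rw [this]
      rw [integral_sub i2 i1, ht, sub_self]
    have e : ∫ x, Jop S Φ η h (fun x => gradient v x - g x) (fun x => v x - w x) x ∂μ =
        - ∫ x, Jop S Φ η h g w x ∂μ := by
      simp_rw [Jop_sub]
      rw [integral_sub (hmem _ _ hgm hvm) (hmem _ _ hg hw), hz, zero_sub]
    rw [← enorm_neg, ← e]
    refine (enorm_integral_le_lintegral_enorm _).trans ?_
    rw [← eLpNorm_one_eq_lintegral_enorm]
    refine (Jop_bound (P := P) hQ hS.1 hΦ.1 h hd2.1 hd1.1 hη0 hη1 hL).trans ?_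
    rw [hC, add_mul, mul_assoc, mul_assoc]
    gcongr
  have ht : Tendsto (fun ε : ℝ≥0∞ => C * ε) (𝓝[>] 0) (𝓝 (C * 0)) :=
    (ENNReal.Tendsto.const_mul tendsto_id (Or.inr hCt)).mono_left nhdsWithin_le_nhds
  have hle := ge_of_tendsto ht (by
    have : ∀ᶠ ε : ℝ≥0∞ in 𝓝[>] 0, ε < ∞ :=
      nhdsWithin_le_nhds (gt_mem_nhds (by simp))
    filter_upwards [this, self_mem_nhdsWithin] with ε h1 h2
    exact key ε h2 h1)
  rw [mul_zero] at hle
  simpa using hle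

end PartE

section PartF
set_option linter.unusedSimpArgs false
open Filter Topology

lemma absorb {X Y P k : ℝ} (hP : 0 ≤ P) (hk : 0 ≤ k) (h : X ^ 2 ≤ k * P) :
    2 * X * Y ≤ P / 2 + 2 * k * Y ^ 2 := by
  rcases hk.eq_or_lt with h0 | h0
  · rw [← h0, zero_mul] at h
    have : X = 0 := by nlinarith
    rw [this, ← h0]; simp; linarith
  · have h1 : 0 ≤ (X - 2 * k * Y) ^ 2 := sq_nonneg _
    have h2 : k * (2 * X * Y) ≤ k * (P / 2 + 2 * k * Y ^ 2) := by nlinarith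
    exact le_of_mul_le_mul_left h2 h0

variable {n : ℕ}

lemma pt_est {q p α : ℝ} (hq : 2 ≤ q) (hp : p = q / (q - 1)) (hα : 0 < α) (hα1 : α < 1)
    (a b G : EuclideanSpace ℝ (Fin n)) {t d φ e L M : ℝ} (ht : 0 < t) (ht1 : t ≤ 1)
    (he0 : 0 ≤ e) (he1 : e ≤ 1) (hG : ‖G‖ ≤ L) (hM0 : 0 ≤ M)
    (hM : e ≠ 0 → |φ| ^ p / t ^ (α * p) ≤ M) :
    e ^ 2 * (tauF a ^ (q / 2) - tauF b ^ (q / 2)) ^ 2 ≤ 2 * q ^ 2 *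
      ((⟪Hmap n (q - 1) a - Hmap n (q - 1) b, e ^ 2 • (a - b) + (2 * e * d) • G⟫
          - φ * (e ^ 2 * d)) +
        t ^ (1 + α) * (2 * q * L ^ 2 * (‖a‖ ^ q + ‖b‖ ^ q + 2 * (|d| / t) ^ q) + M
          + (|d| / t) ^ q)) := by
  have hpq : p.HolderConjugate q := by
    have := Real.HolderConjugate.conjExponent (p := q) (by linarith)
    rw [Real.conjExponent, ← hp] at this
    exact this.symm
  obtain ⟨hk1, hk2⟩ := H_key hq a b
  have hD0 := D_nonneg hq a b
  have hL0 : 0 ≤ L := (norm_nonneg _).trans hG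
  rw [inner_add_right, inner_smul_right, inner_smul_right]
  set ΔH := Hmap n (q - 1) a - Hmap n (q - 1) b
  set D := ⟪ΔH, a - b⟫
  set k := q * (‖a‖ ^ (q - 2) + ‖b‖ ^ (q - 2)) with hkdef
  have hk0 : 0 ≤ k := by positivity
  set δ := |d| / t with hδ
  have hδ0 : 0 ≤ δ := by positivity
  have hdt : |d| = t * δ := by rw [hδ]; field_simp
  have hd2 : d ^ 2 = t ^ 2 * δ ^ 2 := by rw [← sq_abs, hdt]; ring
  have ht2 : t ^ 2 ≤ t ^ (1 + α) := by
    rw [← Real.rpow_two]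
    exact Real.rpow_le_rpow_of_exponent_ge ht ht1 (by linarith)
  have htp : 0 < t ^ (1 + α) := by positivity
  -- gradient term
  have h1 : -(2 * e * d * ⟪ΔH, G⟫) ≤ e ^ 2 * D / 2 + 2 * k * (|d| * L) ^ 2 := by
    have h := absorb (X := e * ‖ΔH‖) (Y := |d| * L) (P := e ^ 2 * D) (k := k) (by positivity) hk0
      (by
        calc (e * ‖ΔH‖) ^ 2 = e ^ 2 * ‖ΔH‖ ^ 2 := by ring
          _ ≤ e ^ 2 * (k * D) := by gcongr
          _ = _ := by ring)
    refine le_trans ?_ h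
    calc -(2 * e * d * ⟪ΔH, G⟫) ≤ |2 * e * d * ⟪ΔH, G⟫| := neg_le_abs _
      _ = 2 * e * |d| * |⟪ΔH, G⟫| := by
        rw [abs_mul, abs_mul, abs_mul, abs_of_nonneg he0]; simp
      _ ≤ 2 * e * |d| * (‖ΔH‖ * L) := by
        gcongr
        exact (abs_real_inner_le_norm _ _).trans (by gcongr)
      _ = _ := by ring
  have h2 : 2 * k * (|d| * L) ^ 2 ≤
      t ^ (1 + α) * (2 * q * L ^ 2 * (‖a‖ ^ q + ‖b‖ ^ q + 2 * δ ^ q)) := by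
    have ha := rpow_mul_sq_le hq (norm_nonneg a) hδ0
    have hb := rpow_mul_sq_le hq (norm_nonneg b) hδ0
    calc 2 * k * (|d| * L) ^ 2 = t ^ 2 * (2 * q * L ^ 2 *
          (‖a‖ ^ (q - 2) * δ ^ 2 + ‖b‖ ^ (q - 2) * δ ^ 2)) := by rw [hdt, hkdef]; ring
      _ ≤ t ^ (1 + α) * (2 * q * L ^ 2 * (‖a‖ ^ q + ‖b‖ ^ q + 2 * δ ^ q)) := by
        exact mul_le_mul ht2 (mul_le_mul_of_nonneg_left (by linarith) (by positivity))
          (by positivity) (by positivity)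
  have h3 : φ * (e ^ 2 * d) ≤ t ^ (1 + α) * (M + δ ^ q) := by
    by_cases he : e = 0
    · rw [he]; simp; positivity
    have hM := hM he
    have hy := Real.young_inequality_of_nonneg (a := |φ| / t ^ α) (b := δ) (by positivity) hδ0 hpq
    have e1 : (|φ| / t ^ α) ^ p = |φ| ^ p / t ^ (α * p) := by
      rw [Real.div_rpow (abs_nonneg _) (by positivity), ← Real.rpow_mul ht.le]
    rw [e1] at hy
    have i1 : |φ| ^ p / t ^ (α * p) / p ≤ |φ| ^ p / t ^ (α * p) :=
      div_le_self (by positivity) hpq.lt.le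
    have i2 : δ ^ q / q ≤ δ ^ q := div_le_self (by positivity) (by linarith)
    calc φ * (e ^ 2 * d) ≤ |φ * (e ^ 2 * d)| := le_abs_self _
      _ = e ^ 2 * (|φ| * |d|) := by rw [abs_mul, abs_mul, abs_of_nonneg (sq_nonneg e)]; ring
      _ ≤ 1 * (|φ| * |d|) := by gcongr; exact pow_le_one₀ he0 he1
      _ = t ^ (1 + α) * (|φ| / t ^ α * δ) := by
        rw [Real.rpow_add ht, Real.rpow_one, hdt]
        have : t ^ α ≠ 0 := by positivity
        field_simp
      _ ≤ t ^ (1 + α) * (M + δ ^ q) := by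
        gcongr
        linarith
  have hfin : e ^ 2 * D ≤ 2 * ((e ^ 2 * D + 2 * e * d * ⟪ΔH, G⟫ - φ * (e ^ 2 * d)) +
      t ^ (1 + α) * (2 * q * L ^ 2 * (‖a‖ ^ q + ‖b‖ ^ q + 2 * δ ^ q) + M + δ ^ q)) := by
    have : t ^ (1 + α) * (2 * q * L ^ 2 * (‖a‖ ^ q + ‖b‖ ^ q + 2 * δ ^ q) + M + δ ^ q) =
      t ^ (1 + α) * (2 * q * L ^ 2 * (‖a‖ ^ q + ‖b‖ ^ q + 2 * δ ^ q)) +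
      t ^ (1 + α) * (M + δ ^ q) := by ring
    rw [this]
    linarith
  calc _ ≤ e ^ 2 * (q ^ 2 * D) := by gcongr
    _ = q ^ 2 * (e ^ 2 * D) := by ring
    _ ≤ q ^ 2 * (2 * _) := by gcongr
    _ = _ := by ring

lemma measurable_Hmap (a : ℝ) : Measurable (Hmap n a) := by
  unfold Hmap
  exact ((((measurable_norm.sub_const 1).max measurable_const).pow_const a).div
    measurable_norm).smul measurable_id

lemma memLp_Hmap {q p : ℝ} (hq : 2 ≤ q) (hp : p = q / (q - 1))
    {μ : Measure (EuclideanSpace ℝ (Fin n))}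
    {g : EuclideanSpace ℝ (Fin n) → EuclideanSpace ℝ (Fin n)}
    (hg : MemLp g (ENNReal.ofReal q) μ) :
    MemLp (fun x => Hmap n (q - 1) (g x)) (ENNReal.ofReal p) μ := by
  have h1 := hg.norm_rpow_div (ENNReal.ofReal (q - 1))
  rw [ENNReal.toReal_ofReal (by linarith), ← ENNReal.ofReal_div_of_pos (by linarith), ← hp] at h1
  refine h1.mono ((measurable_Hmap _).comp_aemeasurable hg.1.aemeasurable).aestronglyMeasurable
    (Eventually.of_forall fun x => ?_)
  rw [norm_Hmap hq, Real.norm_of_nonneg (by positivity)]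
  exact Real.rpow_le_rpow (tauF_nonneg _) (tauF_le _) (by linarith)

lemma gradient_hcs {E : Type*} [NormedAddCommGroup E] [InnerProductSpace ℝ E]
    [FiniteDimensional ℝ E] {ψ : E → ℝ} (hψc : HasCompactSupport ψ) :
    HasCompactSupport (gradient ψ) := by
  refine (hψc.fderiv (𝕜 := ℝ)).mono ?_
  intro x hx
  simp only [Function.mem_support, gradient] at hx ⊢
  intro h0
  simp [h0] at hx

lemma integrable_inner_grad {E : Type*} [NormedAddCommGroup E] [InnerProductSpace ℝ E]
    [FiniteDimensional ℝ E] [MeasurableSpace E] [BorelSpace E] {μ : Measure E}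
    [IsFiniteMeasureOnCompacts μ]
    {P Q : ℝ≥0∞} [P.HolderTriple Q 1] {S : E → E}
    (hS : MemLp S P μ) {ψ : E → ℝ} (hψ : ContDiff ℝ 1 ψ) (hψc : HasCompactSupport ψ) :
    Integrable (fun x => ⟪S x, gradient ψ x⟫) μ := by
  have hgψq : MemLp (gradient ψ) Q μ :=
    (continuous_gradient hψ).memLp_of_hasCompactSupport (gradient_hcs hψc)
  have hb : MemLp (fun x => ‖S x‖ * ‖gradient ψ x‖) 1 μ := by
    rw [memLp_one_iff_integrable]
    exact hS.norm.integrable_mul hgψq.norm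
  rw [← memLp_one_iff_integrable]
  refine hb.mono (hS.1.inner hgψq.1) (Eventually.of_forall fun x => ?_)
  exact (norm_inner_le_norm _ _).trans (le_abs_self _)

lemma gradient_comp_sub {E : Type*} [NormedAddCommGroup E] [InnerProductSpace ℝ E]
    [FiniteDimensional ℝ E] (ψ : E → ℝ) (h x : E) :
    gradient (fun x => ψ (x - h)) x = gradient ψ (x - h) := by
  simp only [gradient]
  rw [fderiv_comp_sub]

lemma htest_translate {E : Type*} [NormedAddCommGroup E] [InnerProductSpace ℝ E]
    [FiniteDimensional ℝ E] [MeasurableSpace E] [BorelSpace E] {μ : Measure E}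
    [μ.IsAddHaarMeasure]
    {P Q : ℝ≥0∞} [P.HolderTriple Q 1] {T : E → E} {F : E → ℝ}
    (hT : MemLp T P μ) (hF : MemLp F P μ) {z : E} {R : ℝ} (hR : 0 < R)
    (hsol : ∀ ψ : E → ℝ, ContDiff ℝ 1 ψ → HasCompactSupport ψ → tsupport ψ ⊆ ball z (3 * R) →
      ∫ x, ⟪T x, gradient ψ x⟫ ∂μ = ∫ x, F x * ψ x ∂μ) {h : E} (hh : ‖h‖ < R)
    {ψ : E → ℝ} (hψ : ContDiff ℝ 1 ψ) (hψc : HasCompactSupport ψ)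
    (hψK : tsupport ψ ⊆ closedBall z (2 * R)) :
    ∫ x, ⟪T (x + h) - T x, gradient ψ x⟫ ∂μ = ∫ x, (F (x + h) - F x) * ψ x ∂μ := by
  have hTh := memLp_translate hT h
  have hFh := memLp_translate hF h
  have hψq : MemLp ψ Q μ := hψ.continuous.memLp_of_hasCompactSupport hψc
  have i1 := integrable_inner_grad (Q := Q) hTh hψ hψc
  have i2 := integrable_inner_grad (Q := Q) hT hψ hψc
  have i3 : Integrable (fun x => F (x + h) * ψ x) μ := hFh.integrable_mul hψq
  have i4 : Integrable (fun x => F x * ψ x) μ := hF.integrable_mul hψq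
  simp_rw [inner_sub_left, sub_mul]
  rw [integral_sub i1 i2, integral_sub i3 i4]
  congr 1
  · have h1 := hsol (fun x => ψ (x - h)) (hψ.comp (contDiff_id.sub contDiff_const))
      (hψc.comp_homeomorph (Homeomorph.subRight h)) (by
        have e : tsupport (fun x => ψ (x - h)) = (fun x => x - h) ⁻¹' tsupport ψ :=
          tsupport_comp_eq_preimage ψ (Homeomorph.subRight h)
        rw [e]
        intro x hx
        have := hψK hx
        rw [mem_closedBall, dist_eq_norm] at this
        rw [mem_ball, dist_eq_norm]
        calc ‖x - z‖ = ‖(x - h - z) + h‖ := by congr 1; abel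
          _ ≤ ‖x - h - z‖ + ‖h‖ := norm_add_le _ _
          _ < 3 * R := by linarith)
    rw [← integral_add_right_eq_self _ h, ← integral_add_right_eq_self (μ := μ)
      (fun x => F x * ψ (x - h)) h] at h1
    simpa only [gradient_comp_sub, add_sub_cancel_right] using h1
  · exact hsol ψ hψ hψc (hψK.trans (closedBall_subset_ball (by linarith)))

end PartF

section PartG
set_option linter.unusedSimpArgs false
open Filter Topology

variable {n : ℕ}

lemma holder_inst {q p : ℝ} (hq : 2 ≤ q) (hp : p = q / (q - 1)) :
    (ENNReal.ofReal p).HolderTriple (ENNReal.ofReal q) 1 := by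
  have hpq : p.HolderConjugate q := by
    have := Real.HolderConjugate.conjExponent (p := q) (by linarith)
    rw [Real.conjExponent, ← hp] at this
    exact this.symm
  exact hpq.ennrealOfReal

lemma integrable_norm_q {E F : Type*} [MeasurableSpace E] {μ : Measure E} [NormedAddCommGroup F]
    {q : ℝ} (hq : 0 < q) {g : E → F} (hg : MemLp g (ENNReal.ofReal q) μ) :
    Integrable (fun x => ‖g x‖ ^ q) μ := by
  have := hg.integrable_norm_rpow (by simpa using hq) (by simp)
  rwa [ENNReal.toReal_ofReal hq.le] at this

lemma diff_int {E : Type*} [NormedAddCommGroup E] [InnerProductSpace ℝ E]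
    [FiniteDimensional ℝ E] [MeasurableSpace E] [BorelSpace E] {μ : Measure E}
    [μ.IsAddHaarMeasure] {q : ℝ} (hq : 1 ≤ q) {w : E → ℝ} {g : E → E}
    (hw : MemLp w (ENNReal.ofReal q) μ) (hg : MemLp g (ENNReal.ofReal q) μ)
    (hweak : ∀ φ : E → ℝ, ContDiff ℝ 1 φ → HasCompactSupport φ →
      ∫ x, w x • gradient φ x ∂μ = -∫ x, φ x • g x ∂μ) {h : E} (hh : h ≠ 0) :
    Integrable (fun x => (|w (x + h) - w x| / ‖h‖) ^ q) μ ∧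
      ∫ x, (|w (x + h) - w x| / ‖h‖) ^ q ∂μ ≤ ∫ x, ‖g x‖ ^ q ∂μ := by
  have hq0 : 0 < q := by linarith
  have ht : 0 < ‖h‖ := norm_pos_iff.mpr hh
  have hd := diff_W1 (by simpa using hq) (by simp) hw hg hweak h
  have hm : MemLp (fun x => w (x + h) - w x) (ENNReal.ofReal q) μ := (memLp_translate hw h).sub hw
  have hi := integrable_norm_q hq0 hm
  simp only [Real.norm_eq_abs] at hi
  have e : ∀ x, (|w (x + h) - w x| / ‖h‖) ^ q = |w (x + h) - w x| ^ q / ‖h‖ ^ q := fun x =>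
    Real.div_rpow (abs_nonneg _) ht.le q
  simp_rw [e]
  refine ⟨hi.div_const _, ?_⟩
  rw [integral_div, div_le_iff₀ (by positivity)]
  rw [hm.eLpNorm_eq_integral_rpow_norm (by simpa using hq0) (by simp),
    hg.eLpNorm_eq_integral_rpow_norm (by simpa using hq0) (by simp),
    ENNReal.toReal_ofReal hq0.le, ← ofReal_norm, ← ENNReal.ofReal_mul (norm_nonneg _)] at hd
  simp only [Real.norm_eq_abs] at hd
  have hA0 : 0 ≤ ∫ x, |w (x + h) - w x| ^ q ∂μ := integral_nonneg fun x => by positivity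
  have hG0 : 0 ≤ ∫ x, ‖g x‖ ^ q ∂μ := integral_nonneg fun x => by positivity
  have hd' := (ENNReal.ofReal_le_ofReal_iff (by positivity)).mp hd
  have := Real.rpow_le_rpow (by positivity) hd' hq0.le
  rw [Real.mul_rpow (norm_nonneg _) (by positivity), ← Real.rpow_mul hA0, ← Real.rpow_mul hG0,
    inv_mul_cancel₀ hq0.ne', Real.rpow_one, Real.rpow_one] at this
  linarith

lemma energy {q p α : ℝ} (hq : 2 ≤ q) (hp : p = q / (q - 1)) (hα : 0 < α) (hα1 : α < 1)
    {w F η : EuclideanSpace ℝ (Fin n) → ℝ}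
    {g : EuclideanSpace ℝ (Fin n) → EuclideanSpace ℝ (Fin n)}
    (hw : MemLp w (ENNReal.ofReal q) volume) (hg : MemLp g (ENNReal.ofReal q) volume)
    (hweak : ∀ φ : EuclideanSpace ℝ (Fin n) → ℝ, ContDiff ℝ 1 φ → HasCompactSupport φ →
      ∫ x, w x • gradient φ x = -∫ x, φ x • g x)
    (hF : MemLp F (ENNReal.ofReal p) volume)
    {z : EuclideanSpace ℝ (Fin n)} {R : ℝ} (hR : 0 < R)
    (hsol : ∀ ψ : EuclideanSpace ℝ (Fin n) → ℝ, ContDiff ℝ 1 ψ → HasCompactSupport ψ →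
      tsupport ψ ⊆ ball z (3 * R) →
      ∫ x, ⟪Hmap n (q - 1) (g x), gradient ψ x⟫ = ∫ x, F x * ψ x)
    (hη : ContDiff ℝ 1 η)
    (hη0 : ∀ x, 0 ≤ η x) (hη1 : ∀ x, η x ≤ 1) {L : ℝ} (hL : ∀ x, ‖gradient η x‖ ≤ L)
    (hηs : Function.support η ⊆ ball z (2 * R))
    {h : EuclideanSpace ℝ (Fin n)} (hh : h ≠ 0) (hhR : ‖h‖ < R) (hh1 : ‖h‖ ≤ 1) {M : ℝ}
    (hM : ∫ x in ball z (2 * R), |F (x + h) - F x| ^ p / ‖h‖ ^ (α * p) ≤ M) :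
    ∫⁻ x, ENNReal.ofReal ((η x) ^ 2 * (tauF (g (x + h)) ^ (q / 2) - tauF (g x) ^ (q / 2)) ^ 2) ≤
      ENNReal.ofReal ((2 * q ^ 2 * (8 * q * L ^ 2 * (∫ x, ‖g x‖ ^ q) + M + ∫ x, ‖g x‖ ^ q)) *
        ‖h‖ ^ (1 + α)) := by
  have := holder_inst hq hp
  have hpq : p.HolderConjugate q := by
    have := Real.HolderConjugate.conjExponent (p := q) (by linarith)
    rw [Real.conjExponent, ← hp] at this
    exact this.symm
  have ht : 0 < ‖h‖ := norm_pos_iff.mpr hh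
  have hT := memLp_Hmap hq hp hg
  have hS := (memLp_translate hT h).sub hT
  have hΦ := (memLp_translate hF h).sub hF
  obtain ⟨hJi, hJ0⟩ := J_zero (Q := ENNReal.ofReal q) (by simp; linarith) (by simp) hS hΦ hη hη0 hη1 hL
    (K := closedBall z (2 * R)) ((closure_mono hηs).trans closure_ball_subset_closedBall)
    (isCompact_closedBall _ _)
    (fun ψ hψ hψc hψK => htest_translate (Q := ENNReal.ofReal q) hT hF hR hsol hhR hψ hψc hψK)
    hw hg hweak h
  have hGi := integrable_norm_q (by linarith : 0 < q) hg
  have hGi' : Integrable (fun x => ‖g (x + h)‖ ^ q) volume := hGi.comp_add_right h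
  obtain ⟨hdi, hdle⟩ := diff_int (by linarith : 1 ≤ q) hw hg hweak hh
  have hFi : Integrable (fun x => |F (x + h) - F x| ^ p / ‖h‖ ^ (α * p)) volume := by
    have := (integrable_norm_q hpq.pos hΦ).div_const (‖h‖ ^ (α * p))
    simpa using this
  have hMi : Integrable ((ball z (2 * R)).indicator
      (fun x => |F (x + h) - F x| ^ p / ‖h‖ ^ (α * p))) volume :=
    hFi.indicator measurableSet_ball
  have hMint : ∫ x, (ball z (2 * R)).indicator
      (fun x => |F (x + h) - F x| ^ p / ‖h‖ ^ (α * p)) x ≤ M := by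
    rwa [integral_indicator measurableSet_ball]
  set Mx := (ball z (2 * R)).indicator (fun x => |F (x + h) - F x| ^ p / ‖h‖ ^ (α * p)) with hMx
  have hMx0 : ∀ x, 0 ≤ Mx x := fun x => Set.indicator_nonneg (fun x _ => by positivity) x
  set J := Jop (fun x => Hmap n (q - 1) (g (x + h)) - Hmap n (q - 1) (g x))
    (fun x => F (x + h) - F x) η h g w with hJ
  have hJi' : Integrable J volume := hJi
  have hJ0' : ∫ x, J x = 0 := hJ0
  set δ := fun x => (|w (x + h) - w x| / ‖h‖) ^ q with hδ
  have hpt : ∀ x, (η x) ^ 2 * (tauF (g (x + h)) ^ (q / 2) - tauF (g x) ^ (q / 2)) ^ 2 ≤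
      2 * q ^ 2 * (J x + ‖h‖ ^ (1 + α) * (2 * q * L ^ 2 * (‖g (x + h)‖ ^ q + ‖g x‖ ^ q + 2 * δ x)
        + Mx x + δ x)) := by
    intro x
    refine pt_est hq hp hα hα1 (g (x + h)) (g x) (gradient η x) ht hh1 (hη0 x) (hη1 x) (hL x)
      (hMx0 x) ?_
    intro hne
    rw [hMx, Set.indicator_of_mem (hηs hne)]
  have hδi : Integrable δ volume := hdi
  have i1 : Integrable (fun x => ‖g (x + h)‖ ^ q + ‖g x‖ ^ q) volume := hGi'.add hGi
  have i2 : Integrable (fun x => 2 * δ x) volume := hδi.const_mul 2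
  have i3 : Integrable (fun x => ‖g (x + h)‖ ^ q + ‖g x‖ ^ q + 2 * δ x) volume := i1.add i2
  have i4 : Integrable (fun x => 2 * q * L ^ 2 * (‖g (x + h)‖ ^ q + ‖g x‖ ^ q + 2 * δ x)) volume :=
    i3.const_mul _
  have i5 : Integrable (fun x => 2 * q * L ^ 2 * (‖g (x + h)‖ ^ q + ‖g x‖ ^ q + 2 * δ x) + Mx x)
    volume := i4.add hMi
  have i6 : Integrable (fun x => 2 * q * L ^ 2 * (‖g (x + h)‖ ^ q + ‖g x‖ ^ q + 2 * δ x) + Mx x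
    + δ x) volume := i5.add hδi
  have i7 : Integrable (fun x => ‖h‖ ^ (1 + α) *
    (2 * q * L ^ 2 * (‖g (x + h)‖ ^ q + ‖g x‖ ^ q + 2 * δ x) + Mx x + δ x)) volume :=
    i6.const_mul _
  have i8 : Integrable (fun x => J x + ‖h‖ ^ (1 + α) *
    (2 * q * L ^ 2 * (‖g (x + h)‖ ^ q + ‖g x‖ ^ q + 2 * δ x) + Mx x + δ x)) volume := hJi.add i7
  have i9 := i8.const_mul (2 * q ^ 2)
  refine (lintegral_mono fun x => ENNReal.ofReal_le_ofReal (hpt x)).trans ?_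
  rw [← ofReal_integral_eq_lintegral_ofReal i9
    (Eventually.of_forall fun x => le_trans (by positivity) (hpt x))]
  apply ENNReal.ofReal_le_ofReal
  have hGt : ∫ x, ‖g (x + h)‖ ^ q = ∫ x, ‖g x‖ ^ q :=
    integral_add_right_eq_self (fun x => ‖g x‖ ^ q) h
  have hδle : ∫ x, δ x ≤ ∫ x, ‖g x‖ ^ q := hdle
  rw [integral_const_mul, integral_add hJi' i7, hJ0', zero_add, integral_const_mul,
    integral_add i5 hδi, integral_add i4 hMi, integral_const_mul, integral_add i1 i2,
    integral_add hGi' hGi, hGt, integral_const_mul]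
  calc 2 * q ^ 2 * (‖h‖ ^ (1 + α) * (2 * q * L ^ 2 *
        ((∫ x, ‖g x‖ ^ q) + (∫ x, ‖g x‖ ^ q) + 2 * ∫ x, δ x) + (∫ x, Mx x) + ∫ x, δ x))
      ≤ 2 * q ^ 2 * (‖h‖ ^ (1 + α) * (2 * q * L ^ 2 *
        ((∫ x, ‖g x‖ ^ q) + (∫ x, ‖g x‖ ^ q) + 2 * ∫ x, ‖g x‖ ^ q) + M + ∫ x, ‖g x‖ ^ q)) := by
        gcongr
    _ = _ := by ring

end PartG

section PartI
set_option linter.unusedSimpArgs false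
open Filter Topology

variable {n : ℕ}

lemma sq_eLpNorm_two {E : Type*} [MeasurableSpace E] {μ : Measure E} (f : E → ℝ) :
    eLpNorm f 2 μ ^ 2 = ∫⁻ x, ENNReal.ofReal (f x ^ 2) ∂μ := by
  have := eLpNorm_nnreal_pow_eq_lintegral (f := f) (μ := μ) (p := 2) (by norm_num)
  simp only [ENNReal.coe_ofNat, NNReal.coe_ofNat, ENNReal.rpow_ofNat] at this
  rw [this]
  refine lintegral_congr fun x => ?_
  rw [← ofReal_norm, ← ENNReal.ofReal_pow (norm_nonneg _), Real.norm_eq_abs, sq_abs]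

lemma eLpNorm_two_le_iff {E : Type*} [MeasurableSpace E] {μ : Measure E} (f : E → ℝ) {c : ℝ}
    (hc : 0 ≤ c) : eLpNorm f 2 μ ≤ ENNReal.ofReal c ↔
      ∫⁻ x, ENNReal.ofReal (f x ^ 2) ∂μ ≤ ENNReal.ofReal (c ^ 2) := by
  rw [← sq_eLpNorm_two, ENNReal.ofReal_pow hc]
  exact (ENNReal.pow_le_pow_left_iff two_ne_zero).symm

lemma diff_add_le {E : Type*} [NormedAddCommGroup E] [InnerProductSpace ℝ E]
    [FiniteDimensional ℝ E] [MeasurableSpace E] [BorelSpace E] {μ : Measure E}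
    [μ.IsAddHaarMeasure] {W : E → ℝ} (hW : AEStronglyMeasurable W μ) (h k : E) :
    eLpNorm (fun x => W (x + (h + k)) - W x) 2 μ ≤
      eLpNorm (fun x => W (x + h) - W x) 2 μ + eLpNorm (fun x => W (x + k) - W x) 2 μ := by
  have hk : AEStronglyMeasurable (fun x => W (x + k)) μ :=
    hW.comp_measurePreserving (measurePreserving_add_right μ k)
  have hh : AEStronglyMeasurable (fun x => W (x + h)) μ :=
    hW.comp_measurePreserving (measurePreserving_add_right μ h)
  have hhk : AEStronglyMeasurable (fun x => W (x + h + k) - W (x + h)) μ :=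
    (hk.sub hW).comp_measurePreserving (measurePreserving_add_right μ h)
  have e : (fun x => W (x + (h + k)) - W x) = (fun x => W (x + h) - W x) +
      fun x => W (x + h + k) - W (x + h) := by
    ext x; simp [add_assoc]
  rw [e]
  refine (eLpNorm_add_le (hh.sub hW) hhk (by norm_num)).trans ?_
  refine add_le_add le_rfl ?_
  exact (eLpNorm_translate (hk.sub hW) h).le

lemma diff_all {W : EuclideanSpace ℝ (Fin n) → ℝ} (hW : AEStronglyMeasurable W volume)
    {C δ β : ℝ} (hC : 0 ≤ C) (hβ : 0 ≤ β)
    (hdir : ∀ (s : Fin n) (t : ℝ), |t| < δ →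
      ∫⁻ x, ENNReal.ofReal ((W (x + t • unitVec n s) - W x) ^ 2) ≤ ENNReal.ofReal (C * |t| ^ β))
    (y : EuclideanSpace ℝ (Fin n)) (hy : ‖y‖ < δ) :
    ∫⁻ x, ENNReal.ofReal ((W (x + y) - W x) ^ 2) ≤
      ENNReal.ofReal ((n ^ 2 * C) * ‖y‖ ^ β) := by
  set c := √(C * ‖y‖ ^ β) with hc
  have hcsq : c ^ 2 = C * ‖y‖ ^ β := Real.sq_sqrt (by positivity)
  have h1 : ∀ s : Fin n, eLpNorm (fun x => W (x + y s • unitVec n s) - W x) 2 volume ≤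
      ENNReal.ofReal c := by
    intro s
    rw [eLpNorm_two_le_iff _ (Real.sqrt_nonneg _), hcsq]
    have hys : |y s| ≤ ‖y‖ := PiLp.norm_apply_le y s
    refine (hdir s (y s) (hys.trans_lt hy)).trans (ENNReal.ofReal_le_ofReal ?_)
    gcongr
  have h2 : ∀ A : Finset (Fin n), eLpNorm (fun x => W (x + ∑ s ∈ A, y s • unitVec n s) - W x) 2
      volume ≤ ENNReal.ofReal (A.card * c) := by
    intro A
    induction A using Finset.induction_on with
    | empty => simp
    | insert a A ha ih =>
      rw [Finset.sum_insert ha, Finset.card_insert_of_notMem ha]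
      refine (diff_add_le hW _ _).trans ?_
      push_cast
      rw [add_mul, one_mul, add_comm, ENNReal.ofReal_add (by positivity) (by positivity)]
      exact add_le_add ih (h1 a)
  have hsum : ∑ s, y s • unitVec n s = y := by
    ext i
    simp [unitVec, Finset.sum_apply, Pi.single_apply]
  have h3 := h2 Finset.univ
  rw [hsum, eLpNorm_two_le_iff _ (by positivity)] at h3
  refine h3.trans (ENNReal.ofReal_le_ofReal ?_)
  rw [mul_pow, hcsq]
  simp [mul_assoc]

lemma lip_of_gradient {E : Type*} [NormedAddCommGroup E] [InnerProductSpace ℝ E]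
    [FiniteDimensional ℝ E] {η : E → ℝ} (hη : ContDiff ℝ 1 η) {L : ℝ}
    (hL : ∀ x, ‖gradient η x‖ ≤ L) (x y : E) : |η y - η x| ≤ L * ‖y - x‖ := by
  refine Convex.norm_image_sub_le_of_norm_fderiv_le (𝕜 := ℝ) (s := Set.univ)
    (fun x _ => hη.differentiable one_ne_zero x) (fun x _ => ?_) convex_univ trivial trivial
  have := hL x
  rwa [gradient, LinearIsometryEquiv.norm_map] at this

set_option maxHeartbeats 1000000 in
lemma higher_int (hn : 2 ≤ n) {q p α : ℝ} (hq : 2 ≤ q) (hp : p = q / (q - 1)) (hα : 0 < α)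
    (hα1 : α < 1)
    {w F η : EuclideanSpace ℝ (Fin n) → ℝ}
    {g : EuclideanSpace ℝ (Fin n) → EuclideanSpace ℝ (Fin n)} (hgm : Measurable g)
    (hw : MemLp w (ENNReal.ofReal q) volume) (hg : MemLp g (ENNReal.ofReal q) volume)
    (hweak : ∀ φ : EuclideanSpace ℝ (Fin n) → ℝ, ContDiff ℝ 1 φ → HasCompactSupport φ →
      ∫ x, w x • gradient φ x = -∫ x, φ x • g x)
    (hF : MemLp F (ENNReal.ofReal p) volume)
    {z : EuclideanSpace ℝ (Fin n)} {R : ℝ} (hR : 0 < R)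
    (hsol : ∀ ψ : EuclideanSpace ℝ (Fin n) → ℝ, ContDiff ℝ 1 ψ → HasCompactSupport ψ →
      tsupport ψ ⊆ ball z (3 * R) →
      ∫ x, ⟪Hmap n (q - 1) (g x), gradient ψ x⟫ = ∫ x, F x * ψ x)
    (hη : ContDiff ℝ 1 η)
    (hη0 : ∀ x, 0 ≤ η x) (hη1 : ∀ x, η x ≤ 1) {L : ℝ} (hL : ∀ x, ‖gradient η x‖ ≤ L)
    (hηs : Function.support η ⊆ ball z (2 * R)) {M : ℝ} (hM0 : 0 ≤ M)
    (hM : ∀ (s : Fin n) (t : ℝ), t ≠ 0 → |t| < R →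
      ∫ x in ball z (2 * R), |F (x + t • unitVec n s) - F x| ^ p / |t| ^ (α * p) ≤ M)
    {m : ℝ} (hm0 : 0 < m) (hm : m < 2 * n / (n - (1 + α))) :
    ∫⁻ x, ENNReal.ofReal ((η x * tauF (g x) ^ (q / 2)) ^ m) < ∞ := by
  set G := ∫ x, ‖g x‖ ^ q with hG
  have hG0 : 0 ≤ G := integral_nonneg fun x => by positivity
  have hL0 : 0 ≤ L := (norm_nonneg _).trans (hL 0)
  have hGi := integrable_norm_q (by linarith : 0 < q) hg
  have hGl : ∫⁻ x, ENNReal.ofReal (‖g x‖ ^ q) = ENNReal.ofReal G :=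
    (ofReal_integral_eq_lintegral_ofReal hGi (Eventually.of_forall fun x => by positivity)).symm
  have htm : Measurable (fun x => tauF (g x) ^ (q / 2)) := by
    unfold tauF
    exact ((hgm.norm.sub_const 1).max measurable_const).pow_const _
  have hVsq : ∀ x, (tauF (g x) ^ (q / 2)) ^ 2 ≤ ‖g x‖ ^ q := by
    intro x
    rw [← Real.rpow_natCast, ← Real.rpow_mul (tauF_nonneg _)]
    have : q / 2 * ((2 : ℕ) : ℝ) = q := by push_cast; ring
    rw [this]
    exact Real.rpow_le_rpow (tauF_nonneg _) (tauF_le _) (by linarith)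
  have hWm : Measurable (fun x => η x * tauF (g x) ^ (q / 2)) := hη.continuous.measurable.mul htm
  set C0 := 2 * q ^ 2 * (8 * q * L ^ 2 * G + M + G) with hC0
  have hC00 : 0 ≤ C0 := by positivity
  have hunit : ∀ s : Fin n, ‖unitVec n s‖ = 1 := by intro s; simp [unitVec]
  have hdir : ∀ (s : Fin n) (t : ℝ), |t| < min R 1 →
      ∫⁻ x, ENNReal.ofReal ((η (x + t • unitVec n s) * tauF (g (x + t • unitVec n s)) ^ (q / 2)
        - η x * tauF (g x) ^ (q / 2)) ^ 2) ≤
        ENNReal.ofReal ((2 * C0 + 2 * L ^ 2 * G) * |t| ^ (1 + α)) := by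
    intro s t ht
    by_cases h0 : t = 0
    · subst h0; simp
    have htpos : 0 < |t| := abs_pos.mpr h0
    have htR : |t| < R := ht.trans_le (min_le_left _ _)
    have ht1 : |t| < 1 := ht.trans_le (min_le_right _ _)
    set h := t • unitVec n s with hh
    have hnorm : ‖h‖ = |t| := by rw [hh, norm_smul, hunit, mul_one, Real.norm_eq_abs]
    have hne : h ≠ 0 := by rw [← norm_pos_iff, hnorm]; exact htpos
    have hen := energy hq hp hα hα1 hw hg hweak hF hR hsol hη hη0 hη1 hL hηs hne
      (by rw [hnorm]; exact htR) (by rw [hnorm]; exact ht1.le) (M := M)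
      (by rw [hnorm]; exact hM s t h0 htR)
    rw [hnorm, ← hG, ← hC0] at hen
    have hpt : ∀ x, (η (x + h) * tauF (g (x + h)) ^ (q / 2) - η x * tauF (g x) ^ (q / 2)) ^ 2 ≤
        2 * ((η x) ^ 2 * (tauF (g (x + h)) ^ (q / 2) - tauF (g x) ^ (q / 2)) ^ 2) +
          2 * L ^ 2 * |t| ^ (1 + α) * ‖g (x + h)‖ ^ q := by
      intro x
      have hl := lip_of_gradient hη hL x (x + h)
      rw [add_sub_cancel_left, hnorm] at hl
      have hsq : (η (x + h) - η x) ^ 2 ≤ L ^ 2 * |t| ^ (1 + α) := by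
        rw [← sq_abs]
        calc |η (x + h) - η x| ^ 2 ≤ (L * |t|) ^ 2 := by gcongr
          _ = L ^ 2 * |t| ^ 2 := by ring
          _ ≤ L ^ 2 * |t| ^ (1 + α) := by
            gcongr
            rw [← Real.rpow_two]
            exact Real.rpow_le_rpow_of_exponent_ge htpos ht1.le (by linarith)
      have hprod : (η (x + h) - η x) ^ 2 * (tauF (g (x + h)) ^ (q / 2)) ^ 2 ≤
          L ^ 2 * |t| ^ (1 + α) * ‖g (x + h)‖ ^ q :=
        mul_le_mul hsq (hVsq _) (by positivity) (by positivity)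
      nlinarith [sq_nonneg (η x * (tauF (g (x + h)) ^ (q / 2) - tauF (g x) ^ (q / 2)) -
        (η (x + h) - η x) * tauF (g (x + h)) ^ (q / 2))]
    have hm1 : Measurable (fun x => (η x) ^ 2 *
        (tauF (g (x + h)) ^ (q / 2) - tauF (g x) ^ (q / 2)) ^ 2) :=
      (hη.continuous.measurable.pow_const 2).mul
        (((htm.comp (measurable_add_const h)).sub htm).pow_const 2)
    calc _ ≤ ∫⁻ x, (2 * ENNReal.ofReal ((η x) ^ 2 *
          (tauF (g (x + h)) ^ (q / 2) - tauF (g x) ^ (q / 2)) ^ 2) +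
          ENNReal.ofReal (2 * L ^ 2 * |t| ^ (1 + α)) * ENNReal.ofReal (‖g (x + h)‖ ^ q)) := by
          refine lintegral_mono fun x => (ENNReal.ofReal_le_ofReal (hpt x)).trans ?_
          rw [ENNReal.ofReal_add (by positivity) (by positivity), ENNReal.ofReal_mul (by norm_num),
            ENNReal.ofReal_mul (p := 2 * L ^ 2 * |t| ^ (1 + α)) (by positivity)]
          simp
      _ ≤ 2 * ENNReal.ofReal (C0 * |t| ^ (1 + α)) +
          ENNReal.ofReal (2 * L ^ 2 * |t| ^ (1 + α)) * ENNReal.ofReal G := by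
          rw [lintegral_add_left (hm1.ennreal_ofReal.const_mul 2),
            lintegral_const_mul _ hm1.ennreal_ofReal,
            lintegral_const_mul' _ _ (by simp),
            lintegral_add_right_eq_self (fun x => ENNReal.ofReal (‖g x‖ ^ q)), hGl]
          gcongr
      _ = _ := by
          have hT0 : 0 ≤ |t| ^ (1 + α) := Real.rpow_nonneg (abs_nonneg _) _
          have hp1 : 0 ≤ 2 * (C0 * |t| ^ (1 + α)) := mul_nonneg two_pos.le (mul_nonneg hC00 hT0)
          have hp2 : 0 ≤ 2 * L ^ 2 * |t| ^ (1 + α) :=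
            mul_nonneg (mul_nonneg two_pos.le (sq_nonneg L)) hT0
          have e : (2 * C0 + 2 * L ^ 2 * G) * |t| ^ (1 + α) =
            2 * (C0 * |t| ^ (1 + α)) + 2 * L ^ 2 * |t| ^ (1 + α) * G := by ring
          rw [e, ENNReal.ofReal_add hp1 (mul_nonneg hp2 hG0), ENNReal.ofReal_mul two_pos.le,
            ENNReal.ofReal_mul hp2, ENNReal.ofReal_ofNat]
  have hall := diff_all hWm.aestronglyMeasurable (C := 2 * C0 + 2 * L ^ 2 * G) (by positivity)
    (by linarith : 0 ≤ 1 + α) hdir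
  clear_value C0 G
  have hn' : (2 : ℝ) ≤ n := by exact_mod_cast hn
  have hfr : (Module.finrank ℝ (EuclideanSpace ℝ (Fin n)) : ℝ) = n := by simp
  have hA0 : 0 ≤ (n : ℝ) ^ 2 * (2 * C0 + 2 * L ^ 2 * G) := by positivity
  have hδ0 : 0 < min R 1 := lt_min hR one_pos
  have hs0 : 0 < (1 + α) / 2 := by linarith
  have hfr0 : 0 < Module.finrank ℝ (EuclideanSpace ℝ (Fin n)) := by simp; omega
  have hs1 : 2 * ((1 + α) / 2) < (Module.finrank ℝ (EuclideanSpace ℝ (Fin n)) : ℝ) := by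
    rw [hfr]; linarith
  have hW0 : ∀ x, 0 ≤ η x * tauF (g x) ^ (q / 2) :=
    fun x => mul_nonneg (hη0 x) (Real.rpow_nonneg (tauF_nonneg _) _)
  refine embed (μ := volume) hWm hW0 ?_ hfr0 hs0 hs1 hA0 hδ0 ?_ ?_ hm0 ?_
  · refine (measure_mono ?_).trans_lt (measure_ball_lt_top (μ := volume) (x := z) (r := 2 * R))
    intro x hx
    apply hηs
    intro h0
    simp [h0] at hx
  · intro y hy
    have e : 2 * ((1 + α) / 2) = 1 + α := by ring
    rw [e]
    exact hall y hy
  · refine (lintegral_mono fun x => ENNReal.ofReal_le_ofReal ?_).trans_lt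
      (hGl.trans_lt ENNReal.ofReal_lt_top)
    rw [Real.rpow_two, mul_pow]
    calc _ ≤ 1 * ‖g x‖ ^ q := by
          gcongr
          · exact pow_le_one₀ (hη0 x) (hη1 x)
          · exact hVsq x
      _ = _ := one_mul _
  · rw [hfr]
    have e : 2 * ((1 + α) / 2) = 1 + α := by ring
    rw [e]
    exact hm

end PartI

section PartK
set_option linter.unusedSimpArgs false
open Filter Topology

variable {n : ℕ}

lemma memLp_of_supp {E F : Type*} [MeasurableSpace E] {μ : Measure E} [NormedAddCommGroup F]
    {Q : ℝ≥0∞} {K : Set E} (hK : MeasurableSet K) {f : E → F} (hf : MemLp f Q (μ.restrict K))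
    (h0 : ∀ x, x ∉ K → f x = 0) : MemLp f Q μ := by
  have e : f = K.indicator f := by
    ext x
    by_cases hx : x ∈ K
    · rw [Set.indicator_of_mem hx]
    · rw [Set.indicator_of_notMem hx, h0 x hx]
  rw [e]
  exact (memLp_indicator_iff_restrict hK).mpr hf

lemma gradient_zero_of_notMem_tsupport {E : Type*} [NormedAddCommGroup E] [InnerProductSpace ℝ E]
    [FiniteDimensional ℝ E] {φ : E → ℝ} {x : E} (hx : x ∉ tsupport φ) : gradient φ x = 0 := by
  have : fderiv ℝ φ x = 0 := by
    by_contra h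
    exact hx (support_fderiv_subset ℝ h)
  rw [gradient, this, map_zero]

lemma gradient_mul' {E : Type*} [NormedAddCommGroup E] [InnerProductSpace ℝ E]
    [FiniteDimensional ℝ E] {χ φ : E → ℝ} (hχ : ContDiff ℝ 1 χ) (hφ : ContDiff ℝ 1 φ) (x : E) :
    gradient (fun x => χ x * φ x) x = χ x • gradient φ x + φ x • gradient χ x := by
  have d1 : HasFDerivAt χ (fderiv ℝ χ x) x := (hχ.differentiable one_ne_zero x).hasFDerivAt
  have d2 : HasFDerivAt φ (fderiv ℝ φ x) x := (hφ.differentiable one_ne_zero x).hasFDerivAt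
  have d4 := (d1.mul d2).hasGradientAt.gradient
  refine Eq.trans d4 ?_
  simp only [gradient, map_add, map_smul]

lemma gradient_lin {E : Type*} [NormedAddCommGroup E] [InnerProductSpace ℝ E]
    [FiniteDimensional ℝ E] {χ φ : E → ℝ} (hχ : ContDiff ℝ 1 χ) (hφ : ContDiff ℝ 1 φ) (c : ℝ)
    (x : E) :
    gradient (fun x => c * χ x + φ x) x = c • gradient χ x + gradient φ x := by
  have d1 : HasFDerivAt χ (fderiv ℝ χ x) x := (hχ.differentiable one_ne_zero x).hasFDerivAt
  have d2 : HasFDerivAt φ (fderiv ℝ φ x) x := (hφ.differentiable one_ne_zero x).hasFDerivAt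
  have d4 := ((d1.const_mul c).add d2).hasGradientAt.gradient
  refine Eq.trans d4 ?_
  simp only [gradient, map_add, map_smul]

/-- Localization of the weak gradient. -/
lemma weak_loc {q : ℝ} (hq : 2 ≤ q) {Ω : Set (EuclideanSpace ℝ (Fin n))} (hΩo : IsOpen Ω)
    {u : EuclideanSpace ℝ (Fin n) → ℝ}
    {Du : EuclideanSpace ℝ (Fin n) → EuclideanSpace ℝ (Fin n)}
    (hu : MemW1Loc n q Ω u Du) {χ : EuclideanSpace ℝ (Fin n) → ℝ} (hχ : ContDiff ℝ 1 χ)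
    (hχc : HasCompactSupport χ) (hχΩ : tsupport χ ⊆ Ω) (hχ0 : ∀ x, 0 ≤ χ x) (hχ1 : ∀ x, χ x ≤ 1) :
    MemLp (fun x => χ x * u x) (ENNReal.ofReal q) volume ∧
    MemLp (fun x => χ x • Du x + u x • gradient χ x) (ENNReal.ofReal q) volume ∧
    ∀ φ : EuclideanSpace ℝ (Fin n) → ℝ, ContDiff ℝ 1 φ → HasCompactSupport φ →
      ∫ x, (χ x * u x) • gradient φ x = -∫ x, φ x • (χ x • Du x + u x • gradient χ x) := by
  set K := tsupport χ with hKdef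
  have hK : IsCompact K := hχc
  have hKm : MeasurableSet K := (isClosed_tsupport χ).measurableSet
  obtain ⟨huK, hDuK⟩ := hu.1 K hK hχΩ
  have z1 : ∀ x, x ∉ K → χ x = 0 := fun x hx => image_eq_zero_of_notMem_tsupport hx
  have z2 : ∀ x, x ∉ K → gradient χ x = 0 := fun x hx => gradient_zero_of_notMem_tsupport hx
  have hgχ := continuous_gradient hχ
  obtain ⟨C, hC⟩ := hgχ.bounded_above_of_compact_support (gradient_hcs hχc)
  refine ⟨?_, ?_, ?_⟩
  · refine memLp_of_supp hKm (huK.mono (hχ.continuous.aestronglyMeasurable.mul huK.1)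
      (Eventually.of_forall fun x => ?_)) (fun x hx => by simp [z1 x hx])
    rw [norm_mul, Real.norm_of_nonneg (hχ0 x)]
    exact mul_le_of_le_one_left (norm_nonneg _) (hχ1 x)
  · refine memLp_of_supp hKm (MemLp.add (f := fun x => χ x • Du x) (g := fun x => u x • gradient χ x)
      (hDuK.mono (hχ.continuous.aestronglyMeasurable.smul hDuK.1)
      (Eventually.of_forall fun x => ?_)) (huK.of_le_mul (c := C)
        (huK.1.smul hgχ.aestronglyMeasurable) (Eventually.of_forall fun x => ?_)))
      (fun x hx => by simp [z1 x hx, z2 x hx])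
    · rw [norm_smul, Real.norm_of_nonneg (hχ0 x)]
      exact mul_le_of_le_one_left (norm_nonneg _) (hχ1 x)
    · rw [norm_smul, mul_comm]
      gcongr
      exact hC x
  · intro φ hφ hφc
    have hgφ := continuous_gradient hφ
    have hq1 : 1 ≤ ENNReal.ofReal q := by simp; linarith
    have hfinK : IsFiniteMeasure (volume.restrict K) := ⟨by
      rw [Measure.restrict_apply_univ]; exact hK.measure_lt_top⟩
    have iu : IntegrableOn u K volume := huK.integrable hq1
    have iDu : IntegrableOn Du K volume := hDuK.integrable hq1
    have ht : tsupport (fun x => χ x * φ x) ⊆ K := tsupport_mul_subset_left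
    have h := hu.2 (fun x => χ x * φ x) (hχ.mul hφ) (hχc.mul_right) (ht.trans hχΩ)
    rw [setIntegral_eq_of_subset_of_forall_sdiff_eq_zero hΩo.measurableSet hχΩ
      (fun x hx => by
        rw [gradient_zero_of_notMem_tsupport (fun h => hx.2 (ht h)), smul_zero]),
      setIntegral_eq_of_subset_of_forall_sdiff_eq_zero hΩo.measurableSet hχΩ
      (fun x hx => by rw [z1 x hx.2, zero_mul, zero_smul])] at h
    rw [← setIntegral_eq_integral_of_forall_compl_eq_zero (s := K)
        (fun x hx => by rw [z1 x hx, zero_mul, zero_smul]),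
      ← setIntegral_eq_integral_of_forall_compl_eq_zero (s := K)
        (f := fun x => φ x • (χ x • Du x + u x • gradient χ x))
        (fun x hx => by simp [z1 x hx, z2 x hx])]
    have j1 : IntegrableOn (fun x => (χ x * u x) • gradient φ x) K volume := by
      have := iu.smul_continuousOn (f := u)
        ((hχ.continuous.smul hgφ).continuousOn (s := K)) hK
      refine this.congr (Eventually.of_forall fun x => ?_)
      simp [smul_smul, mul_comm]
    have j2 : IntegrableOn (fun x => (φ x * u x) • gradient χ x) K volume := by
      have := iu.smul_continuousOn (f := u)
        ((hφ.continuous.smul hgχ).continuousOn (s := K)) hK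
      refine this.congr (Eventually.of_forall fun x => ?_)
      simp [smul_smul, mul_comm]
    have j3 : IntegrableOn (fun x => (χ x * φ x) • Du x) K volume :=
      iDu.continuousOn_smul ((hχ.continuous.mul hφ.continuous).continuousOn) hK
    have e1 : ∫ x in K, u x • gradient (fun x => χ x * φ x) x =
        (∫ x in K, (χ x * u x) • gradient φ x) + ∫ x in K, (φ x * u x) • gradient χ x := by
      rw [← integral_add j1 j2]
      refine integral_congr_ae (Eventually.of_forall fun x => ?_)
      simp only [gradient_mul' hχ hφ, smul_add, smul_smul]
      congr 2 <;> ring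
    have e2 : ∫ x in K, φ x • (χ x • Du x + u x • gradient χ x) =
        (∫ x in K, (χ x * φ x) • Du x) + ∫ x in K, (φ x * u x) • gradient χ x := by
      rw [← integral_add j3 j2]
      refine integral_congr_ae (Eventually.of_forall fun x => ?_)
      simp only [smul_add, smul_smul]
      congr 2; ring
    rw [e2]
    rw [e1] at h
    rw [neg_add, ← h]
    abel

end PartK

section PartM
set_option linter.unusedSimpArgs false
open Filter Topology

variable {n : ℕ}

lemma conj_pq {q p : ℝ} (hq : 2 ≤ q) (hp : p = q / (q - 1)) : p.HolderConjugate q := by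
  have := Real.HolderConjugate.conjExponent (p := q) (by linarith)
  rw [Real.conjExponent, ← hp] at this
  exact this.symm

/-- A globally `L^p` right-hand side, representing `f` on the ball of radius `3 * R`. -/
lemma exists_F {q p α : ℝ} (hq : 2 ≤ q) (hp : p = q / (q - 1))
    {Ω : Set (EuclideanSpace ℝ (Fin n))} (hΩo : IsOpen Ω)
    {u f : EuclideanSpace ℝ (Fin n) → ℝ}
    {Du : EuclideanSpace ℝ (Fin n) → EuclideanSpace ℝ (Fin n)}
    (hu : MemW1Loc n q Ω u Du) (hf : MemBesovLoc n p α Ω f)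
    (hsol : IsLocalWeakSolution n q Ω Du f)
    {z : EuclideanSpace ℝ (Fin n)} {R : ℝ} (hR : 0 < R) (hball : closedBall z (4 * R) ⊆ Ω) :
    ∃ F : EuclideanSpace ℝ (Fin n) → ℝ, MemLp F (ENNReal.ofReal p) volume ∧
      (∃ M, 0 ≤ M ∧ ∀ (s : Fin n) (t : ℝ), t ≠ 0 → |t| < R →
        ∫ x in ball z (2 * R), |F (x + t • unitVec n s) - F x| ^ p / |t| ^ (α * p) ≤ M) ∧
      ∀ ψ : EuclideanSpace ℝ (Fin n) → ℝ, ContDiff ℝ 1 ψ → HasCompactSupport ψ →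
        tsupport ψ ⊆ ball z (3 * R) → ∫ x in Ω, f x * ψ x = ∫ x, F x * ψ x := by
  have hpq := conj_pq hq hp
  have hp0 := hpq.pos
  have h3 : closedBall z (3 * R) ⊆ Ω := (closedBall_subset_closedBall (by linarith)).trans hball
  have h2 : closedBall z (2 * R) ⊆ Ω := (closedBall_subset_closedBall (by linarith)).trans hball
  have h3' : ball z (3 * R) ⊆ Ω := ball_subset_closedBall.trans h3
  by_cases hmeas : AEStronglyMeasurable f (volume.restrict (ball z (3 * R)))
  · refine ⟨(ball z (3 * R)).indicator f, ?_, ?_, ?_⟩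
    · rw [memLp_indicator_iff_restrict measurableSet_ball]
      have hi := (hf z (3 * R) (by linarith) h3).1
      rw [← integrable_norm_rpow_iff hmeas (by simpa using hp0) (by simp),
        ENNReal.toReal_ofReal hp0.le]
      exact hi
    · obtain ⟨B, hB⟩ := (hf z (2 * R) (by linarith) h2).2
      refine ⟨(max B 0) ^ p, by positivity, ?_⟩
      intro s t ht htR
      have e : ∫ x in ball z (2 * R), |(ball z (3 * R)).indicator f (x + t • unitVec n s) -
            (ball z (3 * R)).indicator f x| ^ p / |t| ^ (α * p) =
          ∫ x in ball z (2 * R), |f (x + t • unitVec n s) - f x| ^ p / |t| ^ (α * p) := by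
        refine setIntegral_congr_fun measurableSet_ball fun x hx => ?_
        have hx1 : x ∈ ball z (3 * R) := ball_subset_ball (by linarith) hx
        have hx2 : x + t • unitVec n s ∈ ball z (3 * R) := by
          rw [mem_ball, dist_eq_norm] at hx ⊢
          have hn1 : ‖t • unitVec n s‖ = |t| := by simp [norm_smul, unitVec]
          calc ‖x + t • unitVec n s - z‖ = ‖(x - z) + t • unitVec n s‖ := by congr 1; abel
            _ ≤ ‖x - z‖ + ‖t • unitVec n s‖ := norm_add_le _ _
            _ < 3 * R := by rw [hn1]; linarith
        simp only [Set.indicator_of_mem hx1, Set.indicator_of_mem hx2]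
      rw [e]
      have hle := hB ⟨s, t, ht, rfl⟩
      have hnn : 0 ≤ ∫ x in ball z (2 * R), |f (x + t • unitVec n s) - f x| ^ p / |t| ^ (α * p) :=
        integral_nonneg fun x => by positivity
      have := Real.rpow_le_rpow (by positivity) (hle.trans (le_max_left B 0)) hp0.le
      rwa [← Real.rpow_mul hnn, one_div, inv_mul_cancel₀ hp0.ne', Real.rpow_one] at this
    · intro ψ hψ hψc hψs
      have z0 : ∀ x, x ∉ ball z (3 * R) → ψ x = 0 := fun x hx =>
        image_eq_zero_of_notMem_tsupport fun h => hx (hψs h)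
      rw [setIntegral_eq_of_subset_of_forall_sdiff_eq_zero hΩo.measurableSet h3'
        (fun x hx => by rw [z0 x hx.2, mul_zero]),
        ← setIntegral_eq_integral_of_forall_compl_eq_zero (s := ball z (3 * R)) (μ := volume)
        (f := fun x => (ball z (3 * R)).indicator f x * ψ x) (fun x hx => by rw [z0 x hx, mul_zero])]
      refine setIntegral_congr_fun measurableSet_ball fun x hx => ?_
      simp only [Set.indicator_of_mem hx]
  · refine ⟨fun _ => 0, MemLp.zero', ⟨0, le_rfl, ?_⟩, ?_⟩
    · intro s t _ _
      simp [Real.zero_rpow hp0.ne']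
    intro ψ hψ hψc hψs
    simp only [zero_mul, integral_zero]
    rw [← hsol ψ hψ hψc (hψs.trans h3')]
    let χ : ContDiffBump z := ⟨3 * R, 4 * R, by linarith, by linarith⟩
    have hχ : ContDiff ℝ 1 χ := χ.contDiff
    have hχt : tsupport χ = closedBall z (4 * R) := χ.tsupport_eq
    have hψt : tsupport ψ ⊆ closedBall z (4 * R) :=
      hψs.trans (ball_subset_closedBall.trans (closedBall_subset_closedBall (by linarith)))
    have hzero : ∀ θ : EuclideanSpace ℝ (Fin n) → ℝ, ContDiff ℝ 1 θ →
        tsupport θ ⊆ closedBall z (4 * R) → (∀ x ∈ ball z (3 * R), 0 < θ x) →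
        ∫ x in Ω, ⟪Hmap n (q - 1) (Du x), gradient θ x⟫ = 0 := by
      intro θ hθ hθt hpos
      have hθc : HasCompactSupport θ :=
        (isCompact_closedBall z (4 * R)).of_isClosed_subset (isClosed_tsupport _) hθt
      rw [hsol θ hθ hθc (hθt.trans hball)]
      refine integral_undef fun hInteg => hmeas ?_
      have h1 : AEStronglyMeasurable (fun x => f x * θ x) (volume.restrict (ball z (3 * R))) :=
        (hInteg.1).mono_measure (Measure.restrict_mono h3' le_rfl)
      have h2 : AEStronglyMeasurable (fun x => f x * θ x / θ x)
          (volume.restrict (ball z (3 * R))) :=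
        (h1.aemeasurable.div hθ.continuous.measurable.aemeasurable).aestronglyMeasurable
      refine h2.congr ?_
      rw [EventuallyEq, ae_restrict_iff' measurableSet_ball]
      refine Eventually.of_forall fun x hx => ?_
      exact mul_div_cancel_right₀ _ (hpos x hx).ne'
    obtain ⟨C, hC⟩ := hψ.continuous.bounded_above_of_compact_support hψc
    have hχ1 : ∀ x ∈ ball z (3 * R), χ x = 1 := fun x hx =>
      χ.one_of_mem_closedBall (ball_subset_closedBall hx)
    have t1 := hzero χ hχ hχt.le (fun x hx => by rw [hχ1 x hx]; exact one_pos)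
    have hθt : tsupport (fun x => (C + 1) * χ x + ψ x) ⊆ closedBall z (4 * R) := by
      refine closure_minimal ?_ isClosed_closedBall
      intro x hx
      by_contra hnot
      have a1 : χ x = 0 := image_eq_zero_of_notMem_tsupport (by rw [hχt]; exact hnot)
      have a2 : ψ x = 0 := image_eq_zero_of_notMem_tsupport fun h => hnot (hψt h)
      simp [a1, a2] at hx
    have t2 := hzero (fun x => (C + 1) * χ x + ψ x) ((contDiff_const.mul hχ).add hψ) hθt
      (fun x hx => by
        rw [hχ1 x hx]
        have := (abs_le.mp (hC x)).1
        linarith)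
    have conv : ∀ θ : EuclideanSpace ℝ (Fin n) → ℝ, tsupport θ ⊆ closedBall z (4 * R) →
        ∫ x in Ω, ⟪Hmap n (q - 1) (Du x), gradient θ x⟫ =
        ∫ x in closedBall z (4 * R), ⟪Hmap n (q - 1) (Du x), gradient θ x⟫ := by
      intro θ hθ
      exact setIntegral_eq_of_subset_of_forall_sdiff_eq_zero hΩo.measurableSet hball
        (fun x hx => by
          rw [gradient_zero_of_notMem_tsupport (fun h => hx.2 (hθ h)), inner_zero_right])
    rw [conv _ hχt.le] at t1
    rw [conv _ hθt] at t2
    rw [conv _ hψt]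
    have := holder_inst hq hp
    have hDu := (hu.1 _ (isCompact_closedBall z (4 * R)) hball).2
    have hH := memLp_Hmap hq hp hDu
    have i1 := integrable_inner_grad (Q := ENNReal.ofReal q) hH hχ χ.hasCompactSupport
    have i2 := integrable_inner_grad (Q := ENNReal.ofReal q) hH hψ hψc
    simp_rw [gradient_lin hχ hψ, inner_add_right, inner_smul_right] at t2
    rw [integral_add (i1.const_mul _) i2, integral_const_mul, t1, mul_zero, zero_add] at t2
    exact t2

lemma local_int (hn : 2 ≤ n) {q p α : ℝ} (hq : 2 ≤ q) (hp : p = q / (q - 1)) (hα : 0 < α)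
    (hα1 : α < 1)
    {Ω : Set (EuclideanSpace ℝ (Fin n))} (hΩo : IsOpen Ω)
    {u f : EuclideanSpace ℝ (Fin n) → ℝ}
    {Du : EuclideanSpace ℝ (Fin n) → EuclideanSpace ℝ (Fin n)}
    (hu : MemW1Loc n q Ω u Du) (hf : MemBesovLoc n p α Ω f)
    (hsol : IsLocalWeakSolution n q Ω Du f)
    {z : EuclideanSpace ℝ (Fin n)} {R : ℝ} (hR : 0 < R) (hball : closedBall z (4 * R) ⊆ Ω)
    {r : ℝ} (hr : 1 ≤ r) (hr2 : r < (n : ℝ) * p / ((n : ℝ) - α - 1)) :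
    IntegrableOn (fun x => ‖Hmap n (q - 1) (Du x)‖ ^ r) (ball z R) volume := by
  have hpq := conj_pq hq hp
  have hp0 := hpq.pos
  obtain ⟨F, hF, ⟨M, hM0, hM⟩, hFψ⟩ := exists_F hq hp hΩo hu hf hsol hR hball
  let χ : ContDiffBump z := ⟨3 * R, 4 * R, by linarith, by linarith⟩
  have hχ : ContDiff ℝ 1 χ := χ.contDiff
  have hχt : tsupport χ = closedBall z (4 * R) := χ.tsupport_eq
  obtain ⟨hw, hg0, hweak0⟩ := weak_loc hq hΩo hu hχ χ.hasCompactSupport (hχt.le.trans hball)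
    (fun x => χ.nonneg) (fun x => χ.le_one)
  set g0 := fun x => χ x • Du x + u x • gradient χ x with hg0def
  have hg0eq : ∀ x ∈ ball z (3 * R), g0 x = Du x := by
    intro x hx
    have a1 : χ x = 1 := χ.one_of_mem_closedBall (ball_subset_closedBall hx)
    have a2 : gradient χ x = 0 := by
      have : (χ : EuclideanSpace ℝ (Fin n) → ℝ) =ᶠ[𝓝 x] fun _ => (1 : ℝ) := by
        filter_upwards [isOpen_ball.mem_nhds hx] with y hy
        exact χ.one_of_mem_closedBall (ball_subset_closedBall hy)
      rw [gradient, this.fderiv_eq]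
      simp
    simp [hg0def, a1, a2]
  set g := hg0.1.mk g0 with hgdef
  have hgae : g0 =ᵐ[volume] g := hg0.1.ae_eq_mk
  have hgm : Measurable g := hg0.1.stronglyMeasurable_mk.measurable
  have hg : MemLp g (ENNReal.ofReal q) volume := hg0.ae_eq hgae
  have hweak : ∀ φ : EuclideanSpace ℝ (Fin n) → ℝ, ContDiff ℝ 1 φ → HasCompactSupport φ →
      ∫ x, (χ x * u x) • gradient φ x = -∫ x, φ x • g x := by
    intro φ hφ hφc
    rw [hweak0 φ hφ hφc]
    congr 1
    refine integral_congr_ae ?_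
    filter_upwards [hgae] with x hx
    rw [← hx]
  have h3 : ball z (3 * R) ⊆ Ω :=
    (ball_subset_closedBall.trans (closedBall_subset_closedBall (by linarith))).trans hball
  have hsol' : ∀ ψ : EuclideanSpace ℝ (Fin n) → ℝ, ContDiff ℝ 1 ψ → HasCompactSupport ψ →
      tsupport ψ ⊆ ball z (3 * R) →
      ∫ x, ⟪Hmap n (q - 1) (g x), gradient ψ x⟫ = ∫ x, F x * ψ x := by
    intro ψ hψ hψc hψs
    rw [← hFψ ψ hψ hψc hψs, ← hsol ψ hψ hψc (hψs.trans h3)]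
    rw [setIntegral_eq_integral_of_forall_compl_eq_zero (s := Ω)
      (fun x hx => by
        rw [gradient_zero_of_notMem_tsupport (fun h => hx (h3 (hψs h))), inner_zero_right])]
    refine integral_congr_ae ?_
    filter_upwards [hgae] with x hx
    by_cases hxs : x ∈ tsupport ψ
    · rw [← hx, hg0eq x (hψs hxs)]
    · rw [gradient_zero_of_notMem_tsupport hxs, inner_zero_right, inner_zero_right]
  let η : ContDiffBump z := ⟨R, 2 * R, hR, by linarith⟩
  have hη : ContDiff ℝ 1 η := η.contDiff
  obtain ⟨L, hL⟩ := (continuous_gradient hη).bounded_above_of_compact_support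
    (gradient_hcs η.hasCompactSupport)
  have hn' : (2 : ℝ) ≤ n := by exact_mod_cast hn
  have hden : 0 < (n : ℝ) - α - 1 := by linarith
  have hm0 : 0 < 2 * r / p := by positivity
  have hm : 2 * r / p < 2 * n / (n - (1 + α)) := by
    have e : (n : ℝ) - (1 + α) = n - α - 1 := by ring
    rw [lt_div_iff₀ hden] at hr2
    rw [e, div_lt_div_iff₀ hp0 hden]
    linarith
  have hfin := higher_int hn hq hp hα hα1 hgm hw hg hweak hF hR hsol' hη (fun x => η.nonneg)
    (fun x => η.le_one) hL η.support_eq.le hM0 hM hm0 hm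
  have hInteg : Integrable (fun x => (η x * tauF (g x) ^ (q / 2)) ^ (2 * r / p)) volume := by
    have hmeas : Measurable (fun x => (η x * tauF (g x) ^ (q / 2)) ^ (2 * r / p)) := by
      unfold tauF
      exact (hη.continuous.measurable.mul
        (((hgm.norm.sub_const 1).max measurable_const).pow_const _)).pow_const _
    refine ⟨hmeas.aestronglyMeasurable, ?_⟩
    rw [hasFiniteIntegral_iff_ofReal (Eventually.of_forall fun x => ?_)]
    · exact hfin
    · exact Real.rpow_nonneg (mul_nonneg η.nonneg (Real.rpow_nonneg (tauF_nonneg _) _)) _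
  refine (hInteg.integrableOn (s := ball z R)).congr ?_
  rw [EventuallyEq, ae_restrict_iff' measurableSet_ball]
  filter_upwards [hgae] with x hx hxb
  have b1 : η x = 1 := η.one_of_mem_closedBall (ball_subset_closedBall hxb)
  rw [← hx, hg0eq x (ball_subset_ball (by linarith) hxb), b1, one_mul, norm_Hmap hq,
    ← Real.rpow_mul (tauF_nonneg _), ← Real.rpow_mul (tauF_nonneg _)]
  congr 1
  have : q - 1 ≠ 0 := by linarith
  have : q ≠ 0 := by linarith
  rw [hp]
  field_simp

end PartM

/-- **Corollary (higher integrability of the optimal traffic flow, `q ≥ 2`).**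
Let `n ≥ 2`, `q ≥ 2`, `p = q/(q−1)`, `α ∈ (0,1)`, `Ω ⊂ ℝⁿ` bounded open,
`f ∈ B^α_{p,∞,loc}(Ω)`, let `u ∈ W^{1,q}_loc(Ω)` be a local weak solution of
`−div((|∇u|−1)_+^{q−1}∇u/|∇u|) = f`, and set `σ₀ = H_{q−1}(∇u)`.  Then
`σ₀ ∈ L^r_loc(Ω)` for all `r ∈ [1, np/(n−α−1))`. -/
theorem stmt18 (n : ℕ) (hn : 2 ≤ n) (q p α : ℝ) (hq : 2 ≤ q)
    (hp : p = q / (q - 1)) (hα1 : 0 < α) (hα2 : α < 1)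
    (Ω : Set (EuclideanSpace ℝ (Fin n))) (hΩo : IsOpen Ω) (hΩb : Bornology.IsBounded Ω)
    (u f : EuclideanSpace ℝ (Fin n) → ℝ)
    (Du : EuclideanSpace ℝ (Fin n) → EuclideanSpace ℝ (Fin n))
    (hu : MemW1Loc n q Ω u Du)
    (hf : MemBesovLoc n p α Ω f)
    (hsol : IsLocalWeakSolution n q Ω Du f)
    (σ₀ : EuclideanSpace ℝ (Fin n) → EuclideanSpace ℝ (Fin n))
    (hσ₀ : σ₀ = fun x => Hmap n (q - 1) (Du x)) :
    ∀ r : ℝ, 1 ≤ r → r < (n : ℝ) * p / ((n : ℝ) - α - 1) →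
      ∀ K : Set (EuclideanSpace ℝ (Fin n)), IsCompact K → K ⊆ Ω →
        IntegrableOn (fun x => ‖σ₀ x‖ ^ r) K volume := by
  intro r hr hr2 K hK hKΩ
  subst hσ₀
  have hloc : LocallyIntegrableOn (fun x => ‖Hmap n (q - 1) (Du x)‖ ^ r) K volume := by
    intro z hz
    obtain ⟨ε, hε, hεb⟩ := Metric.isOpen_iff.mp hΩo z (hKΩ hz)
    have hR : 0 < ε / 8 := by linarith
    have hb : closedBall z (4 * (ε / 8)) ⊆ Ω :=
      (closedBall_subset_ball (by linarith)).trans hεb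
    exact ⟨ball z (ε / 8), mem_nhdsWithin_of_mem_nhds (ball_mem_nhds z hR),
      local_int hn hq hp hα1 hα2 hΩo hu hf hsol hR hb hr hr2⟩
  exact hloc.integrableOn_isCompact hK
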